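/- arXiv:1805.07168 — 11 statements merged into one kernel-verified Lean document; each statement's English description precedes it below -/
import Mathlib

section
/- For every integer d ≥ 2 and every n ≥ 1 there exists a map g from the set of fully reducible words of length 2n over the alphabet {1,…,d} to the set of fully reducible words of length 2n−2 such that: (i) for every fully reducible word a of length 2n there is an index i with a_i = a_{i+1} and g(a) equals a with the letters at positions i and i+1 deleted; and (ii) every fully reducible word of length 2n−2 has at least one and at most 4(d−1) preimages under g. -/
open scoped Classical

/-- One step of the stack-based reduction: push the letter if the stack is empty or
its top differs from the current letter, otherwise pop the top. -/
def redStep {d : ℕ} (s : List (Fin d)) (a : Fin d) : List (Fin d) :=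
  match s with
  | [] => [a]
  | b :: rest => if a = b then rest else a :: b :: rest

/-- The irreducible string of a word: the final stack content read from bottom to top. -/
def irrOf {d N : ℕ} (w : Fin N → Fin d) : List (Fin d) :=
  ((List.ofFn w).foldl redStep []).reverse

/-- A word is fully reducible if its irreducible string is empty. -/
def FullyReducible {d N : ℕ} (w : Fin N → Fin d) : Prop := irrOf w = []

/-- The word `a` with the letters at positions `i` and `i+1` deleted. -/
def deletePairAt {d N : ℕ} (a : Fin N → Fin d) (i : ℕ) : Fin (N - 2) → Fin d :=
  fun p =>
    if (p : ℕ) < i then a ⟨(p : ℕ), by have := p.isLt; omega⟩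
    else a ⟨(p : ℕ) + 2, by have := p.isLt; omega⟩

namespace SuperTree

/-- Edge-coloured plane trees, via first-return decomposition. -/
inductive Tr (d : ℕ) : Type
  | nil : Tr d
  | node : Fin d → Tr d → Tr d → Tr d

namespace Tr

def size {d : ℕ} : Tr d → ℕ
  | nil => 0
  | node _ A B => size A + size B + 1

def word {d : ℕ} : Tr d → List (Fin d)
  | nil => []
  | node y A B => y :: (word A ++ y :: word B)

def Valid {d : ℕ} : Option (Fin d) → Tr d → Prop
  | _, nil => True
  | x, node y A B => x ≠ some y ∧ Valid (some y) A ∧ Valid x B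

end Tr

open Tr

lemma word_length {d : ℕ} (t : Tr d) : t.word.length = 2 * t.size := by
  induction t with
  | nil => rfl
  | node y A B ihA ihB => simp [word, size, ihA, ihB]; ring

lemma word_inj {d : ℕ} (A : Tr d) : ∀ (x : Option (Fin d)) (A' : Tr d) (r r' : List (Fin d)),
    A.Valid x → A'.Valid x → r.head? = x → r'.head? = x → A.word ++ r = A'.word ++ r' →
    A = A' ∧ r = r' := by
  induction A with
  | nil =>
    intro x A' r r' _ h' hr hr' h
    cases A' with
    | nil => exact ⟨rfl, by simpa [word] using h⟩
    | node y C B =>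
      simp only [word, List.nil_append, List.cons_append] at h
      subst h
      exact absurd hr.symm h'.1
  | node y C B ihC ihB =>
    intro x A' r r' hv h' hr hr' h
    cases A' with
    | nil =>
      simp only [word, List.nil_append, List.cons_append] at h
      subst h
      exact absurd hr'.symm hv.1
    | node y' C' B' =>
      simp only [word, List.append_assoc, List.cons_append, List.cons.injEq] at h
      obtain ⟨rfl, h⟩ := h
      obtain ⟨rfl, h2⟩ := ihC (some y) C' _ _ hv.2.1 h'.2.1 rfl rfl h
      obtain ⟨rfl, h3⟩ := ihB x B' r r' hv.2.2 h'.2.2 hr hr' (by simpa using h2)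
      exact ⟨rfl, h3⟩

lemma word_inj_none {d : ℕ} {A A' : Tr d} (h : A.Valid none) (h' : A'.Valid none)
    (e : A.word = A'.word) : A = A' :=
  (word_inj A none A' [] [] h h' rfl rfl (by simpa using e)).1

lemma foldl_word {d : ℕ} (A : Tr d) : ∀ s : List (Fin d), A.Valid s.head? →
    A.word.foldl redStep s = s := by
  induction A with
  | nil => intro s _; rfl
  | node y C B ihC ihB =>
    intro s hv
    have h1 : redStep s y = y :: s := by
      cases s with
      | nil => rfl
      | cons z s =>
        have : y ≠ z := by
          rintro rfl
          exact hv.1 rfl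
        simp [redStep, this]
    simp only [word, List.foldl_cons, List.foldl_append, h1]
    rw [ihC (y :: s) hv.2.1]
    have h2 : redStep (y :: s) y = s := by simp [redStep]
    rw [h2]
    exact ihB s hv.2.2

def Parse {d : ℕ} : List (Fin d) → List (Fin d) → Prop
  | [], w => ∃ A : Tr d, A.Valid none ∧ w = A.word
  | x :: s, w => ∃ (A : Tr d) (w' : List (Fin d)), A.Valid (some x) ∧
      w = A.word ++ x :: w' ∧ Parse s w'

lemma parse_of {d : ℕ} (w : List (Fin d)) : ∀ s : List (Fin d),
    w.foldl redStep s = [] → Parse s w := by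
  induction w with
  | nil =>
    intro s h
    simp only [List.foldl_nil] at h
    subst h
    exact ⟨nil, trivial, rfl⟩
  | cons c w ih =>
    intro s h
    rw [List.foldl_cons] at h
    have := ih _ h
    cases s with
    | nil =>
      obtain ⟨A, w', hA, rfl, B, hB, rfl⟩ := this
      exact ⟨node c A B, ⟨by simp, hA, hB⟩, rfl⟩
    | cons x s =>
      by_cases hc : c = x
      · subst hc
        simp only [redStep, if_true] at this
        exact ⟨nil, w, trivial, rfl, this⟩
      · simp only [redStep, if_neg hc] at this
        obtain ⟨A, w', hA, rfl, B, w'', hB, rfl, hp⟩ := this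
        exact ⟨node c A B, w'', ⟨by simpa using fun h => hc h.symm, hA, hB⟩,
          by simp [word], hp⟩

/-- `l'` is `l` with an adjacent equal pair deleted. -/
def DelL {d : ℕ} (l l' : List (Fin d)) : Prop :=
  ∃ u v c, l = u ++ c :: c :: v ∧ l' = u ++ v

inductive TD {d : ℕ} : Tr d → Tr d → Prop
  | base (y : Fin d) : TD (node y nil nil) nil
  | left (y : Fin d) (A A' B : Tr d) : TD A A' → TD (node y A B) (node y A' B)
  | right (y : Fin d) (A B B' : Tr d) : TD B B' → TD (node y A B) (node y A B')

lemma TD.size {d : ℕ} {s t : Tr d} (h : TD s t) : s.size = t.size + 1 := by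
  induction h with
  | base y => rfl
  | left y A A' B h ih => simp [Tr.size, ih]; omega
  | right y A B B' h ih => simp [Tr.size, ih]; omega

lemma TD.valid {d : ℕ} {s t : Tr d} (h : TD s t) : ∀ x, s.Valid x → t.Valid x := by
  induction h with
  | base y => intro x _; trivial
  | left y A A' B h ih => intro x hv; exact ⟨hv.1, ih _ hv.2.1, hv.2.2⟩
  | right y A B B' h ih => intro x hv; exact ⟨hv.1, hv.2.1, ih _ hv.2.2⟩

lemma TD.del {d : ℕ} {s t : Tr d} (h : TD s t) : DelL s.word t.word := by
  induction h with
  | base y => exact ⟨[], [], y, rfl, rfl⟩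
  | left y A A' B h ih =>
    obtain ⟨u, v, c, h1, h2⟩ := ih
    exact ⟨y :: u, v ++ y :: B.word, c, by simp [word, h1], by simp [word, h2]⟩
  | right y A B B' h ih =>
    obtain ⟨u, v, c, h1, h2⟩ := ih
    exact ⟨y :: (A.word ++ y :: u), v, c, by simp [word, h1], by simp [word, h2]⟩

/-- Probability of recursing into the left part. -/
def pr {d : ℕ} : Option (Fin d) → ℕ → ℕ → ℚ
  | none, a, b => (a * (a + 1)) / ((a + b) * (a + b + 1))
  | some _, a, b => (a * (a + 1) * (a + 3 * b + 2)) / ((a + b) * (a + b + 1) * (a + b + 2))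

/-- Normalised inflow. -/
def rate {d : ℕ} : Option (Fin d) → ℕ → ℚ
  | none, n => 4 - 2 / (n + 1)
  | some _, n => 4 - 6 / (n + 2)

lemma pr_nonneg {d : ℕ} (x : Option (Fin d)) (a b : ℕ) : 0 ≤ pr x a b := by
  cases x <;> simp only [pr] <;> positivity

lemma pr_le_one {d : ℕ} (x : Option (Fin d)) (a b : ℕ) : pr x a b ≤ 1 := by
  have ha : (0 : ℚ) ≤ a := by positivity
  have hb : (0 : ℚ) ≤ b := by positivity
  cases x <;> simp only [pr] <;> apply div_le_one_of_le₀ _ (by positivity)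
  · nlinarith [mul_nonneg ha hb]
  · have : (0 : ℚ) ≤ b * (b + 1) * (b + 3 * a + 2) := by positivity
    nlinarith

lemma pr_zero_left {d : ℕ} (x : Option (Fin d)) (b : ℕ) : pr x 0 b = 0 := by
  cases x <;> simp [pr]

lemma pr_zero_right {d : ℕ} (x : Option (Fin d)) (a : ℕ) (ha : a ≠ 0) : pr x a 0 = 1 := by
  have : (a : ℚ) ≠ 0 := by exact_mod_cast ha
  have h1 : (a : ℚ) + 1 ≠ 0 := by positivity
  have h2 : (a : ℚ) + 2 ≠ 0 := by positivity
  cases x <;> simp only [pr, Nat.cast_zero, mul_zero, add_zero] <;> exact div_self (by positivity)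

lemma rate_rec {d : ℕ} (x : Option (Fin d)) (y : Fin d) (a b : ℕ) :
    pr x (a + 1) b * rate (some y) a + (1 - pr x a (b + 1)) * rate x b
      = rate x (a + b + 1) := by
  have h0 : (a : ℚ) + b + 1 ≠ 0 := by positivity
  have h1 : (a : ℚ) + b + 2 ≠ 0 := by positivity
  have h2 : (a : ℚ) + b + 3 ≠ 0 := by positivity
  have h3 : (a : ℚ) + 2 ≠ 0 := by positivity
  have h4 : (b : ℚ) + 2 ≠ 0 := by positivity
  have h5 : (b : ℚ) + 1 ≠ 0 := by positivity
  have e1 : (a : ℚ) + 1 + b = a + b + 1 := by ring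
  have e2 : (a : ℚ) + (b + 1) = a + b + 1 := by ring
  have e3 : (a : ℚ) + b + 1 + 1 = a + b + 2 := by ring
  have e4 : (a : ℚ) + b + 1 + 2 = a + b + 3 := by ring
  cases x <;> simp only [pr, rate] <;> push_cast <;> simp only [e1, e2, e3, e4] <;>
    field_simp <;> ring

/-- The fractional transport plan. -/
noncomputable def wt {d : ℕ} : Option (Fin d) → Tr d → Tr d → ℚ
  | _, nil, _ => 0
  | _, node _ A B, nil => if A = nil ∧ B = nil then 1 else 0
  | x, node y A B, node y' A' B' =>
      (if y' = y ∧ B' = B then pr x A.size B.size * wt (some y) A A' else 0) +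
      (if y' = y ∧ A' = A then (1 - pr x A.size B.size) * wt x B B' else 0)

lemma inj_left {d : ℕ} (y : Fin d) (B : Tr d) : Function.Injective (fun A => node y A B) := by
  intro A A' h; simpa using h

lemma inj_right {d : ℕ} (y : Fin d) (A : Tr d) : Function.Injective (fun B => node y A B) := by
  intro A A' h; simpa using h

lemma size_eq_zero {d : ℕ} {t : Tr d} (h : t.size = 0) : t = nil := by
  cases t with
  | nil => rfl
  | node y A B => simp [Tr.size] at h

lemma out_sum {d : ℕ} (s : Tr d) : ∀ (x : Option (Fin d)) (N : Finset (Tr d)), s ≠ nil →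
    (∀ t, TD s t → t ∈ N) → ∑ t ∈ N, wt x s t = 1 := by
  induction s with
  | nil => intro x N h; exact absurd rfl h
  | node y A B ihA ihB =>
    intro x N _ hN
    by_cases h0 : A = nil ∧ B = nil
    · obtain ⟨rfl, rfl⟩ := h0
      rw [Finset.sum_eq_single_of_mem nil (hN _ (TD.base y))]
      · simp [wt]
      · intro t _ ht
        cases t with
        | nil => exact absurd rfl ht
        | node y' A' B' => simp [wt]
    · let g1 : Tr d → ℚ := fun t => match t with
        | nil => 0
        | node y' A' B' => if y' = y ∧ B' = B then pr x A.size B.size * wt (some y) A A' else 0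
      let g2 : Tr d → ℚ := fun t => match t with
        | nil => 0
        | node y' A' B' => if y' = y ∧ A' = A then (1 - pr x A.size B.size) * wt x B B' else 0
      have e : ∀ t, wt x (node y A B) t = g1 t + g2 t := by
        intro t
        cases t with
        | nil => simp [wt, g1, g2, h0]
        | node y' A' B' => simp only [wt, g1, g2]
      simp only [e, Finset.sum_add_distrib]
      rw [← Finset.sum_preimage (fun A' => node y A' B) N (inj_left y B).injOn g1,
        ← Finset.sum_preimage (fun B' => node y A B') N (inj_right y A).injOn g2]
      · simp only [g1, g2, and_self, if_true, ← Finset.mul_sum]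
        by_cases hA : A = nil
        · subst hA
          have hB : B ≠ nil := fun h => h0 ⟨rfl, h⟩
          rw [ihB x _ hB]
          · simp [Tr.size, pr_zero_left]
          · intro t ht
            simpa using hN _ (TD.right y _ _ _ ht)
        · rw [ihA (some y) _ hA]
          · by_cases hB : B = nil
            · subst hB
              have : A.size ≠ 0 := fun h => hA (size_eq_zero h)
              simp [Tr.size, pr_zero_right, this]
            · rw [ihB x _ hB]
              · ring
              · intro t ht
                simpa using hN _ (TD.right y _ _ _ ht)
          · intro t ht
            simpa using hN _ (TD.left y _ _ _ ht)
      · intro t _ ht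
        cases t with
        | nil => rfl
        | node y' A' B' =>
          simp only [g2]
          rw [if_neg]
          rintro ⟨rfl, rfl⟩
          exact ht ⟨B', rfl⟩
      · intro t _ ht
        cases t with
        | nil => rfl
        | node y' A' B' =>
          simp only [g1]
          rw [if_neg]
          rintro ⟨rfl, rfl⟩
          exact ht ⟨A', rfl⟩

lemma in_sum {d : ℕ} (hd : 2 ≤ d) (t : Tr d) : ∀ (x : Option (Fin d)) (S : Finset (Tr d)),
    (∀ s ∈ S, s.Valid x ∧ s.size = t.size + 1) →
    ∑ s ∈ S, wt x s t ≤ ((d : ℚ) - 1) * rate x t.size := by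
  have hd' : (2 : ℚ) ≤ d := by exact_mod_cast hd
  induction t with
  | nil =>
    intro x S hS
    let U : Finset (Fin d) := Finset.univ.filter (fun y => x ≠ some y)
    have hsub : S ⊆ U.image (fun y => node y nil nil) := by
      intro s hs
      obtain ⟨hv, hz⟩ := hS s hs
      cases s with
      | nil => simp [Tr.size] at hz
      | node y A B =>
        simp only [Tr.size] at hz
        obtain rfl : A = nil := size_eq_zero (by omega)
        obtain rfl : B = nil := size_eq_zero (by omega)
        simp only [Finset.mem_image]
        exact ⟨y, by simpa [U] using hv.1, rfl⟩
    have h1 : ∑ s ∈ S, wt x s nil ≤ S.card := by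
      rw [Finset.card_eq_sum_ones, Nat.cast_sum]
      apply Finset.sum_le_sum
      intro s _
      cases s with
      | nil => simp [wt]
      | node y A B => simp only [wt]; split_ifs <;> simp
    have h2 : (S.card : ℚ) ≤ U.card := by
      exact_mod_cast (Finset.card_le_card hsub).trans Finset.card_image_le
    have h3 : (U.card : ℚ) ≤ ((d : ℚ) - 1) * rate x 0 := by
      cases x with
      | none =>
        simp [U, rate]
        linarith
      | some z =>
        have : U = Finset.univ.erase z := by
          ext y; simp [U, eq_comm]
        rw [this, Finset.card_erase_of_mem (Finset.mem_univ _), Finset.card_univ,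
          Fintype.card_fin, Nat.cast_sub (by omega)]
        simp [rate]; linarith
    exact h1.trans (h2.trans h3)
  | node y A B ihA ihB =>
    intro x S hS
    let g1 : Tr d → ℚ := fun s => match s with
        | nil => 0
        | node y' A' B' => if y = y' ∧ B = B' then pr x A'.size B'.size * wt (some y') A' A else 0
    let g2 : Tr d → ℚ := fun s => match s with
        | nil => 0
        | node y' A' B' => if y = y' ∧ A = A' then (1 - pr x A'.size B'.size) * wt x B' B else 0
    have e : ∀ s, wt x s (node y A B) = g1 s + g2 s := by
      intro s
      cases s with
      | nil => simp [wt, g1, g2]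
      | node y' A' B' => simp only [wt, g1, g2]
    simp only [e, Finset.sum_add_distrib]
    rw [← Finset.sum_preimage (fun A' => node y A' B) S (inj_left y B).injOn g1,
        ← Finset.sum_preimage (fun B' => node y A B') S (inj_right y A).injOn g2]
    · simp only [g1, g2, and_self, if_true]
      have hA : ∀ s ∈ S.preimage (fun A' => node y A' B) (inj_left y B).injOn,
          s.Valid (some y) ∧ s.size = A.size + 1 := by
        intro s hs
        rw [Finset.mem_preimage] at hs
        obtain ⟨hv, hz⟩ := hS _ hs
        simp only [Tr.size] at hz
        exact ⟨hv.2.1, by omega⟩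
      have hB : ∀ s ∈ S.preimage (fun B' => node y A B') (inj_right y A).injOn,
          s.Valid x ∧ s.size = B.size + 1 := by
        intro s hs
        rw [Finset.mem_preimage] at hs
        obtain ⟨hv, hz⟩ := hS _ hs
        simp only [Tr.size] at hz
        exact ⟨hv.2.2, by omega⟩
      have s1 : ∑ s ∈ S.preimage (fun A' => node y A' B) (inj_left y B).injOn,
          pr x s.size B.size * wt (some y) s A = pr x (A.size + 1) B.size *
          ∑ s ∈ S.preimage (fun A' => node y A' B) (inj_left y B).injOn, wt (some y) s A := by
        rw [Finset.mul_sum]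
        exact Finset.sum_congr rfl (fun s hs => by rw [(hA s hs).2])
      have s2 : ∑ s ∈ S.preimage (fun B' => node y A B') (inj_right y A).injOn,
          (1 - pr x A.size s.size) * wt x s B = (1 - pr x A.size (B.size + 1)) *
          ∑ s ∈ S.preimage (fun B' => node y A B') (inj_right y A).injOn, wt x s B := by
        rw [Finset.mul_sum]
        exact Finset.sum_congr rfl (fun s hs => by rw [(hB s hs).2])
      rw [s1, s2]
      have i1 := mul_le_mul_of_nonneg_left (ihA (some y) _ hA) (pr_nonneg x (A.size + 1) B.size)
      have i2 := mul_le_mul_of_nonneg_left (ihB x _ hB)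
        (sub_nonneg.2 (pr_le_one x A.size (B.size + 1)))
      have i3 := rate_rec x y A.size B.size
      simp only [Tr.size]
      rw [← i3]
      linarith
    · intro t _ ht
      cases t with
      | nil => rfl
      | node y' A' B' =>
        simp only [g2]
        rw [if_neg]
        rintro ⟨rfl, rfl⟩
        exact ht ⟨B', rfl⟩
    · intro t _ ht
      cases t with
      | nil => rfl
      | node y' A' B' =>
        simp only [g1]
        rw [if_neg]
        rintro ⟨rfl, rfl⟩
        exact ht ⟨A', rfl⟩

lemma card_le {d : ℕ} (hd : 2 ≤ d) (n : ℕ) (S N : Finset (Tr d))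
    (hS : ∀ s ∈ S, s.Valid none ∧ s.size = n + 1) (hN : ∀ t ∈ N, t.size = n)
    (h : ∀ s ∈ S, ∀ t, TD s t → t ∈ N) : S.card ≤ 4 * (d - 1) * N.card := by
  have hd' : (2 : ℚ) ≤ d := by exact_mod_cast hd
  have h1 : (S.card : ℚ) = ∑ s ∈ S, ∑ t ∈ N, wt none s t := by
    rw [Finset.card_eq_sum_ones, Nat.cast_sum]
    apply Finset.sum_congr rfl
    intro s hs
    rw [out_sum s none N _ (h s hs)]
    · simp
    · rintro rfl
      have := (hS _ hs).2
      simp [Tr.size] at this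
  have h2 : (S.card : ℚ) ≤ N.card * (4 * ((d : ℚ) - 1)) := by
    rw [h1, Finset.sum_comm, ← nsmul_eq_mul]
    apply Finset.sum_le_card_nsmul
    intro t ht
    refine (in_sum hd t none S ?_).trans ?_
    · intro s hs
      rw [hN t ht]
      exact hS s hs
    · have : rate (none : Option (Fin d)) t.size ≤ 4 := by
        simp only [rate]
        have : (0 : ℚ) ≤ 2 / (t.size + 1) := by positivity
        linarith
      nlinarith
  have h3 : ((4 * (d - 1) * N.card : ℕ) : ℚ) = N.card * (4 * ((d : ℚ) - 1)) := by
    push_cast [Nat.cast_sub (show 1 ≤ d by omega)]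
    ring
  rw [← h3] at h2
  exact_mod_cast h2

/-- Hall's theorem with capacities. -/
lemma hall_cap {α β : Type} [Fintype α] [Fintype β] (R : α → β → Prop) (K : ℕ)
    (h : ∀ S : Finset α, S.card ≤ K * (Finset.univ.filter (fun b => ∃ a ∈ S, R a b)).card) :
    ∃ f : α → β, (∀ a, R a (f a)) ∧ ∀ b, Set.ncard {a | f a = b} ≤ K := by
  obtain ⟨F, hF, hm⟩ := (Finset.all_card_le_biUnion_card_iff_exists_injective
    (fun a : α => (Finset.univ.filter (fun b => R a b)) ×ˢ (Finset.univ : Finset (Fin K)))).1 (by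
      intro S
      refine (h S).trans (le_of_eq ?_)
      have : S.biUnion (fun a : α => (Finset.univ.filter (fun b => R a b)) ×ˢ
          (Finset.univ : Finset (Fin K))) =
          (Finset.univ.filter (fun b => ∃ a ∈ S, R a b)) ×ˢ (Finset.univ : Finset (Fin K)) := by
        ext ⟨b, k⟩
        simp
      rw [this, Finset.card_product, Finset.card_univ, Fintype.card_fin, mul_comm])
  refine ⟨fun a => (F a).1, fun a => by simpa using hm a, fun b => ?_⟩
  have := Set.ncard_le_ncard_of_injOn (s := {a | (F a).1 = b}) (t := (Set.univ : Set (Fin K)))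
    (fun a => (F a).2) (by simp) (by
      intro a ha a' ha' e
      apply hF
      exact Prod.ext (ha.trans ha'.symm) e) Set.finite_univ
  simpa [Set.ncard_univ] using this

inductive Reach {α β : Type} (f : α → β) (m : β → α) : β → Prop
  | base (b : β) : (∀ a, f a ≠ b) → Reach f m b
  | step (b : β) : Reach f m b → Reach f m (f (m b))

/-- Make the assignment surjective, in the style of Cantor-Bernstein. -/
lemma combine {α β : Type} [Fintype α] [Fintype β] (R : α → β → Prop) (K : ℕ) (hK : 1 ≤ K)
    (f : α → β) (hf : ∀ a, R a (f a)) (hfK : ∀ b, Set.ncard {a | f a = b} ≤ K)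
    (m : β → α) (hm : Function.Injective m) (hmR : ∀ b, R (m b) b) :
    ∃ g : α → β, (∀ a, R a (g a)) ∧
      ∀ b, 1 ≤ Set.ncard {a | g a = b} ∧ Set.ncard {a | g a = b} ≤ K := by
  let g : α → β := fun a =>
    if h : ∃ b, Reach f m b ∧ m b = a then h.choose else f a
  have g1 : ∀ b, Reach f m b → g (m b) = b := by
    intro b hb
    have h : ∃ b', Reach f m b' ∧ m b' = m b := ⟨b, hb, rfl⟩
    simp only [g, dif_pos h]
    exact hm h.choose_spec.2
  have g2 : ∀ a, (¬ ∃ b, Reach f m b ∧ m b = a) → g a = f a := by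
    intro a h
    simp only [g, dif_neg h]
  refine ⟨g, ?_, ?_⟩
  · intro a
    by_cases h : ∃ b, Reach f m b ∧ m b = a
    · obtain ⟨b, hb, rfl⟩ := h
      rw [g1 b hb]
      exact hmR b
    · rw [g2 a h]
      exact hf a
  · intro b
    constructor
    · rw [Nat.one_le_iff_ne_zero, ← Nat.pos_iff_ne_zero, Set.ncard_pos (Set.toFinite _)]
      by_cases hb : Reach f m b
      · exact ⟨m b, g1 b hb⟩
      · by_cases h : ∃ a, f a = b
        · obtain ⟨a, rfl⟩ := h
          refine ⟨a, g2 a ?_⟩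
          rintro ⟨b, hb', rfl⟩
          exact hb (Reach.step b hb')
        · exact absurd (Reach.base b (by simpa using h)) hb
    · by_cases hb : Reach f m b
      · have key : {a | g a = b} ⊆ insert (m b) ({a | f a = b} \ {a | ∃ b, Reach f m b ∧ m b = a}) := by
          intro a ha
          by_cases h : ∃ b, Reach f m b ∧ m b = a
          · obtain ⟨b', hb', rfl⟩ := h
            left
            rw [← (g1 b' hb').symm.trans ha]
          · right
            exact ⟨(g2 a h).symm.trans ha, h⟩
        refine (Set.ncard_le_ncard key (Set.toFinite _)).trans ?_
        refine (Set.ncard_insert_le _ _).trans ?_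
        cases hb with
        | base _ h =>
          have : {a | f a = b} = ∅ := by
            ext a; simpa using h a
          simpa [this] using hK
        | step b' hb' =>
          refine Nat.succ_le_of_lt (lt_of_lt_of_le ?_ (hfK (f (m b'))))
          apply Set.ncard_lt_ncard _ (Set.toFinite _)
          refine ⟨Set.sdiff_subset, fun hsub => ?_⟩
          exact (hsub (show m b' ∈ {a | f a = f (m b')} from rfl)).2 ⟨b', hb', rfl⟩
      · refine (Set.ncard_le_ncard ?_ (Set.toFinite _)).trans (hfK b)
        intro a ha
        by_cases h : ∃ b, Reach f m b ∧ m b = a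
        · obtain ⟨b', hb', rfl⟩ := h
          exact absurd (((g1 b' hb').symm.trans ha) ▸ hb') hb
        · exact (g2 a h).symm.trans ha

lemma fr_iff {d N : ℕ} (w : Fin N → Fin d) :
    FullyReducible w ↔ (List.ofFn w).foldl redStep [] = [] := by
  simp [FullyReducible, irrOf]

lemma exists_tree {d N : ℕ} (w : Fin (2 * N) → Fin d) (h : FullyReducible w) :
    ∃ t : Tr d, t.Valid none ∧ t.word = List.ofFn w ∧ t.size = N := by
  obtain ⟨A, hA, e⟩ := parse_of _ [] ((fr_iff w).1 h)
  refine ⟨A, hA, e.symm, ?_⟩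
  have := word_length A
  rw [← e, List.length_ofFn] at this
  omega

lemma exists_word {d N : ℕ} (t : Tr d) (h : t.Valid none) (hs : t.size = N) :
    ∃ w : Fin (2 * N) → Fin d, FullyReducible w ∧ List.ofFn w = t.word := by
  have hl : t.word.length = 2 * N := by rw [word_length, hs]
  have e : List.ofFn (fun i : Fin (2 * N) => t.word.get (i.cast hl.symm)) = t.word := by
    apply List.ext_getElem
    · simp [hl]
    · intro i h1 h2
      simp
  exact ⟨_, (fr_iff _).2 (by rw [e]; exact foldl_word t [] h), e⟩

lemma del_pair {d M : ℕ} (a : Fin (M + 2) → Fin d) (b : Fin M → Fin d)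
    (h : DelL (List.ofFn a) (List.ofFn b)) :
    ∃ i : ℕ, ∃ h : i + 1 < M + 2, a ⟨i, by omega⟩ = a ⟨i + 1, h⟩ ∧ b = deletePairAt a i := by
  obtain ⟨u, v, c, h1, h2⟩ := h
  have hl := congrArg List.length h2
  simp only [List.length_ofFn, List.length_append] at hl
  have ha : ∀ i (hi : i < M + 2), a ⟨i, hi⟩ = (u ++ c :: c :: v)[i]'(by simp; omega) := by
    intro i hi
    simp only [← h1, List.getElem_ofFn]
  have hb : ∀ i (hi : i < M), b ⟨i, hi⟩ = (u ++ v)[i]'(by simp; omega) := by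
    intro i hi
    simp only [← h2, List.getElem_ofFn]
  refine ⟨u.length, by omega, ?_, ?_⟩
  · rw [ha, ha]
    simp [List.getElem_append]
  · funext ⟨p, hp⟩
    rw [hb p hp]
    simp only [deletePairAt]
    split_ifs with hlt
    · rw [ha]
      simp [List.getElem_append, hlt]
    · rw [ha]
      have e : p + 2 - u.length = (p - u.length) + 2 := by omega
      have hlt' : ¬ (p + 2 < u.length) := by omega
      simp [List.getElem_append, hlt, hlt', e]

lemma main {d : ℕ} (hd : 2 ≤ d) (n : ℕ) :
    ∃ g : {a : Fin (2 * (n + 1)) → Fin d // FullyReducible a} →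
        {b : Fin (2 * n) → Fin d // FullyReducible b},
      (∀ a, DelL (List.ofFn a.1) (List.ofFn (g a).1)) ∧
      ∀ b, 1 ≤ Set.ncard {a | g a = b} ∧ Set.ncard {a | g a = b} ≤ 4 * (d - 1) := by
  let R : {a : Fin (2 * (n + 1)) → Fin d // FullyReducible a} →
        {b : Fin (2 * n) → Fin d // FullyReducible b} → Prop :=
    fun a b => DelL (List.ofFn a.1) (List.ofFn b.1)
  choose pa pav paw pas using
    fun a : {a : Fin (2 * (n + 1)) → Fin d // FullyReducible a} => exists_tree a.1 a.2
  choose pb pbv pbw pbs using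
    fun b : {b : Fin (2 * n) → Fin d // FullyReducible b} => exists_tree b.1 b.2
  have pa_inj : Function.Injective pa := by
    intro a a' e
    apply Subtype.ext
    apply List.ofFn_injective
    rw [← paw, ← paw, e]
  obtain ⟨f, hf, hfK⟩ := hall_cap R (4 * (d - 1)) (by
    intro S
    have := card_le hd n (S.image pa)
      ((Finset.univ.filter (fun b => ∃ a ∈ S, R a b)).image pb)
      (by
        intro s hs
        obtain ⟨a, _, rfl⟩ := Finset.mem_image.1 hs
        exact ⟨pav a, pas a⟩)
      (by
        intro t ht
        obtain ⟨b, _, rfl⟩ := Finset.mem_image.1 ht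
        exact pbs b)
      (by
        intro s hs t htd
        obtain ⟨a, ha, rfl⟩ := Finset.mem_image.1 hs
        have hv := htd.valid none (pav a)
        have hz : t.size = n := by
          have := htd.size
          rw [pas a] at this
          omega
        obtain ⟨w, hw, e⟩ := exists_word t hv hz
        refine Finset.mem_image.2 ⟨⟨w, hw⟩, ?_, ?_⟩
        · simp only [Finset.mem_filter, Finset.mem_univ, true_and]
          refine ⟨a, ha, ?_⟩
          simp only [R]
          rw [e, ← paw]
          exact htd.del
        · exact word_inj_none (pbv _) hv ((pbw _).trans e))
    rw [Finset.card_image_of_injective _ pa_inj] at this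
    exact this.trans (Nat.mul_le_mul_left _ Finset.card_image_le))
  let z : Fin d := ⟨0, by omega⟩
  have hm : ∀ b : {b : Fin (2 * n) → Fin d // FullyReducible b},
      ∃ a : {a : Fin (2 * (n + 1)) → Fin d // FullyReducible a},
        List.ofFn a.1 = z :: z :: List.ofFn b.1 := by
    intro b
    obtain ⟨a, e⟩ : ∃ a : Fin (2 * n + 1 + 1) → Fin d, List.ofFn a = z :: z :: List.ofFn b.1 :=
      ⟨Fin.cons z (Fin.cons z b.1 : Fin (2 * n + 1) → Fin d), by
        rw [List.ofFn_succ, List.ofFn_succ]; simp⟩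
    change ∃ a : {a : Fin (2 * n + 1 + 1) → Fin d // FullyReducible a},
      List.ofFn a.1 = z :: z :: List.ofFn b.1
    refine ⟨⟨a, (fr_iff _).2 ?_⟩, e⟩
    rw [e]
    simpa [redStep] using (fr_iff _).1 b.2
  choose m hm using hm
  refine combine R (4 * (d - 1)) (by omega) f hf hfK m ?_ ?_
  · intro b b' e
    apply Subtype.ext
    apply List.ofFn_injective
    have := (hm b).symm.trans ((congrArg (fun a => List.ofFn a.1) e).trans (hm b'))
    simpa using this
  · intro b
    exact ⟨[], List.ofFn b.1, z, hm b, rfl⟩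

end SuperTree

/-- existence of a parent-assignment map `g` from fully reducible words of
length `2n` to fully reducible words of length `2n−2`, obtained by deleting an adjacent
equal pair, such that every fully reducible word of length `2n−2` has at least one and
at most `4(d−1)` preimages. -/
theorem pf_supertree (d : ℕ) (hd : 2 ≤ d) (n : ℕ) (hn : 1 ≤ n) :
    ∃ g : (Fin (2 * n) → Fin d) → (Fin (2 * n - 2) → Fin d),
      (∀ a : Fin (2 * n) → Fin d, FullyReducible a →
        FullyReducible (g a) ∧
        ∃ i : ℕ, ∃ h : i + 1 < 2 * n,
          a ⟨i, by omega⟩ = a ⟨i + 1, h⟩ ∧ g a = deletePairAt a i) ∧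
      (∀ b : Fin (2 * n - 2) → Fin d, FullyReducible b →
        1 ≤ Set.ncard {a : Fin (2 * n) → Fin d | FullyReducible a ∧ g a = b} ∧
        Set.ncard {a : Fin (2 * n) → Fin d | FullyReducible a ∧ g a = b} ≤ 4 * (d - 1)) := by
  obtain ⟨n, rfl⟩ : ∃ k, n = k + 1 := ⟨n - 1, by omega⟩
  obtain ⟨g, hg, hc⟩ := SuperTree.main hd n
  let G : (Fin (2 * (n + 1)) → Fin d) → (Fin (2 * (n + 1) - 2) → Fin d) := fun a =>
    if h : FullyReducible a then (g ⟨a, h⟩).1 else fun _ => ⟨0, by omega⟩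
  have hG : ∀ a (h : FullyReducible a), G a = (g ⟨a, h⟩).1 := fun a h => dif_pos h
  refine ⟨G, ?_, ?_⟩
  · intro a ha
    rw [hG a ha]
    refine ⟨(g ⟨a, ha⟩).2, ?_⟩
    exact SuperTree.del_pair (M := 2 * n) a _ (hg ⟨a, ha⟩)
  · intro b hb
    have e : {a : Fin (2 * (n + 1)) → Fin d | FullyReducible a ∧ G a = b}
        = Subtype.val '' {a | g a = ⟨b, hb⟩} := by
      ext a
      constructor
      · rintro ⟨ha, h⟩
        exact ⟨⟨a, ha⟩, Subtype.ext ((hG a ha).symm.trans h), rfl⟩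
      · rintro ⟨⟨a, ha⟩, h, rfl⟩
        exact ⟨ha, (hG a ha).trans (congrArg Subtype.val h)⟩
    rw [e, Set.ncard_image_of_injective _ Subtype.val_injective]
    exact hc ⟨b, hb⟩
end

section
/- For every n ≥ 1, the total number of peaks summed over all Dyck words of semilength n equals binomial(2n−1, n) = ((n+1)/2) · C_n. -/
open scoped Classical

/-- A Dyck word of semilength `n`, encoded as a function `Fin (2n) → Bool`
(`true` = U, `false` = D): it has exactly `n` letters U and every prefix contains
at least as many U's as D's. -/
def IsDyckWord (n : ℕ) (w : Fin (2 * n) → Bool) : Prop :=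
  (List.ofFn w).count true = n ∧
  ∀ m ≤ 2 * n,
    ((List.ofFn w).take m).count false ≤ ((List.ofFn w).take m).count true

/-- The number of peaks (an index `i` with `w_i = U` and `w_{i+1} = D`) of a word. -/
def peaksCount (l : List Bool) : ℕ :=
  (List.zipWith (fun a b => a && !b) l l.tail).count true

/-- The number of valleys (an index `i` with `w_i = D` and `w_{i+1} = U`) of a word. -/
def valleysCount (l : List Bool) : ℕ :=
  (List.zipWith (fun a b => !a && b) l l.tail).count true

/-- `l` is a path from height `h` to height `0` that never goes below `0`. -/
def goodPath : ℕ → List Bool → Prop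
  | h, [] => h = 0
  | h, true :: l => goodPath (h + 1) l
  | 0, false :: _ => False
  | h + 1, false :: l => goodPath h l

theorem goodPath_iff (l : List Bool) : ∀ h, goodPath h l ↔
    (l.count false = h + l.count true ∧
      ∀ m, (l.take m).count false ≤ h + (l.take m).count true) := by
  induction l with
  | nil => intro h; simp [goodPath]; omega
  | cons b l ih =>
    intro h
    cases b with
    | true =>
      simp only [goodPath, ih]
      constructor
      · rintro ⟨h1, h2⟩
        refine ⟨by simp; omega, ?_⟩
        intro m
        cases m with
        | zero => simp
        | succ m => have := h2 m; simp; omega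
      · rintro ⟨h1, h2⟩
        refine ⟨by simp at h1; omega, ?_⟩
        intro m
        have := h2 (m + 1)
        simp at this; omega
    | false =>
      cases h with
      | zero =>
        simp only [goodPath, false_iff]
        rintro ⟨h1, h2⟩
        have := h2 1
        simp at this
      | succ h =>
        simp only [goodPath, ih]
        constructor
        · rintro ⟨h1, h2⟩
          refine ⟨by simp; omega, ?_⟩
          intro m
          cases m with
          | zero => simp
          | succ m => have := h2 m; simp; omega
        · rintro ⟨h1, h2⟩
          refine ⟨by simp at h1; omega, ?_⟩
          intro m
          have := h2 (m + 1)
          simp at this; omega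

theorem isDyckWord_iff (n : ℕ) (w : Fin (2 * n) → Bool) :
    IsDyckWord n w ↔ goodPath 0 (List.ofFn w) := by
  rw [goodPath_iff, IsDyckWord]
  have hlen : (List.ofFn w).length = 2 * n := by simp
  have hc := List.count_true_add_count_false (List.ofFn w)
  constructor
  · rintro ⟨h1, h2⟩
    refine ⟨by omega, ?_⟩
    intro m
    by_cases hm : m ≤ 2 * n
    · have := h2 m hm; omega
    · rw [List.take_of_length_le (by omega)]; omega
  · rintro ⟨h1, h2⟩
    refine ⟨by omega, ?_⟩
    intro m _
    have := h2 m; omega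

/-- Sum of `f` over all words of length `m`. -/
def wordSum (f : List Bool → ℕ) (m : ℕ) : ℕ := ∑ w : Fin m → Bool, f (List.ofFn w)

theorem wordSum_zero (f : List Bool → ℕ) : wordSum f 0 = f [] := by
  simp [wordSum]

theorem wordSum_succ (f : List Bool → ℕ) (m : ℕ) :
    wordSum f (m + 1) =
      wordSum (fun l => f (true :: l)) m + wordSum (fun l => f (false :: l)) m := by
  unfold wordSum
  rw [← (Fin.consEquiv (fun _ : Fin (m + 1) => Bool)).sum_comp, Fintype.sum_prod_type]
  simp [Fin.consEquiv, List.ofFn_succ]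

theorem wordSum_add (f g : List Bool → ℕ) (m : ℕ) :
    wordSum (fun l => f l + g l) m = wordSum f m + wordSum g m := by
  simp [wordSum, Finset.sum_add_distrib]

theorem wordSum_const_zero (m : ℕ) : wordSum (fun _ => 0) m = 0 := by
  simp [wordSum]

/-- Number of good paths. -/
noncomputable def pathN (m h : ℕ) : ℕ := wordSum (fun l => if goodPath h l then 1 else 0) m

/-- Total number of peaks of good paths. -/
noncomputable def pathP (m h : ℕ) : ℕ :=
  wordSum (fun l => if goodPath h l then peaksCount l else 0) m

/-- Binomial coefficient with lower index shifted down by one. -/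
def chooseP (m : ℕ) : ℕ → ℕ
  | 0 => 0
  | e + 1 => m.choose e

theorem pascal (m d : ℕ) : (m + 1).choose d = chooseP m d + m.choose d := by
  cases d with
  | zero => simp [chooseP]
  | succ d => simp [chooseP, Nat.choose_succ_succ]

theorem pathN_zero (h : ℕ) : pathN 0 h = if h = 0 then 1 else 0 := by
  rw [pathN, wordSum_zero]
  by_cases hh : h = 0 <;> simp [goodPath, hh]

theorem pathN_succ_zero (m : ℕ) : pathN (m + 1) 0 = pathN m 1 := by
  simp [pathN, wordSum_succ, goodPath, wordSum_const_zero]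

theorem pathN_succ_succ (m h : ℕ) : pathN (m + 1) (h + 1) = pathN m (h + 2) + pathN m h := by
  rw [pathN, wordSum_succ]
  rfl

theorem pathN_lt (m : ℕ) : ∀ h, m < h → pathN m h = 0 := by
  induction m with
  | zero => intro h hh; rw [pathN_zero, if_neg (by omega)]
  | succ m ih =>
    intro h hh
    obtain ⟨k, rfl⟩ : ∃ k, h = k + 1 := ⟨h - 1, by omega⟩
    rw [pathN_succ_succ, ih _ (by omega), ih _ (by omega)]

theorem pathN_eq (m : ℕ) : ∀ d h, m = 2 * d + h → pathN m h + chooseP m d = m.choose d := by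
  induction m with
  | zero =>
    intro d h hm
    obtain rfl : d = 0 := by omega
    obtain rfl : h = 0 := by omega
    simp [pathN_zero, chooseP]
  | succ m ih =>
    intro d h hm
    cases h with
    | zero =>
      obtain ⟨e, rfl⟩ : ∃ e, d = e + 1 := ⟨d - 1, by omega⟩
      rw [pathN_succ_zero]
      have h1 := ih e 1 (by omega)
      have h2 := pascal m e
      have h3 := Nat.choose_succ_succ m e
      have h4 : m.choose e = m.choose (e + 1) := by
        rw [← Nat.choose_symm_of_eq_add (show m = e + (e + 1) by omega)]
      simp only [chooseP, Nat.succ_eq_add_one] at *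
      omega
    | succ h =>
      rw [pathN_succ_succ]
      have h1 := ih d h (by omega)
      cases d with
      | zero => rw [pathN_lt _ _ (by omega)]; simp [chooseP] at *; omega
      | succ e =>
        have h0 := ih e (h + 2) (by omega)
        have h2 := pascal m e
        have h3 := pascal m (e + 1)
        simp only [chooseP] at *
        omega

theorem peaks_false (l : List Bool) : peaksCount (false :: l) = peaksCount l := by
  cases l <;> simp [peaksCount]

theorem peaks_true_true (l : List Bool) :
    peaksCount (true :: true :: l) = peaksCount (true :: l) := by
  simp [peaksCount]

theorem peaks_true_false (l : List Bool) :
    peaksCount (true :: false :: l) = peaksCount (false :: l) + 1 := by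
  simp [peaksCount]

theorem pathP_zero (h : ℕ) : pathP 0 h = 0 := by
  simp [pathP, wordSum_zero, peaksCount]

theorem pathP_one (h : ℕ) : pathP 1 h = 0 := by
  simp [pathP, wordSum_zero, wordSum_succ, peaksCount]

theorem pathP_up (m h : ℕ) :
    wordSum (fun l => if goodPath h (true :: l) then peaksCount (true :: l) else 0) (m + 1)
      = pathP (m + 1) (h + 1) + pathN m h := by
  have key : ∀ l, (if goodPath h l then peaksCount (false :: l) + 1 else 0)
      = (if goodPath h l then peaksCount (false :: l) else 0) + (if goodPath h l then 1 else 0) := by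
    intro l; split_ifs <;> rfl
  have h1 : wordSum (fun l => if goodPath h (true :: false :: l) then
      peaksCount (true :: false :: l) else 0) m
      = wordSum (fun l => if goodPath h l then peaksCount (false :: l) else 0) m + pathN m h := by
    rw [pathN, ← wordSum_add]
    congr 1
    funext l
    rw [← key, ← peaks_true_false]
    rfl
  have h2 : wordSum (fun l => if goodPath h (true :: true :: l) then
      peaksCount (true :: true :: l) else 0) m
      = wordSum (fun l => if goodPath (h + 1) (true :: l) then peaksCount (true :: l) else 0) m := by
    congr 1
  rw [wordSum_succ, pathP, wordSum_succ, h1, h2, ← add_assoc]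
  rfl

theorem pathP_succ_zero (m : ℕ) : pathP (m + 2) 0 = pathP (m + 1) 1 + pathN m 0 := by
  rw [← pathP_up, pathP, wordSum_succ]
  simp [goodPath, wordSum_const_zero]

theorem pathP_succ_succ (m h : ℕ) :
    pathP (m + 2) (h + 1) = pathP (m + 1) (h + 2) + pathP (m + 1) h + pathN m (h + 1) := by
  have := pathP_up m (h + 1)
  rw [pathP, wordSum_succ, this]
  simp only [goodPath, peaks_false]
  have e : wordSum (fun l => if goodPath h l then peaksCount l else 0) (m + 1)
      = pathP (m + 1) h := rfl
  rw [add_right_comm, ← e]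

theorem pathP_lt (m : ℕ) : ∀ h, m ≤ h → pathP m h = 0 := by
  induction m with
  | zero => intro h _; exact pathP_zero h
  | succ m ih =>
    intro h hh
    cases m with
    | zero => exact pathP_one h
    | succ m =>
      obtain ⟨k, rfl⟩ : ∃ k, h = k + 1 := ⟨h - 1, by omega⟩
      rw [pathP_succ_succ, ih _ (by omega), ih _ (by omega), pathN_lt _ _ (by omega)]

theorem pathP_eq (m : ℕ) : ∀ e h, m = 2 * e + h →
    pathP (m + 2) h = (h + 1) * (m + 1).choose e := by
  induction m with
  | zero =>
    intro e h hm
    obtain rfl : e = 0 := by omega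
    obtain rfl : h = 0 := by omega
    rw [pathP_succ_zero, pathP_one, pathN_zero]; simp
  | succ m ih =>
    intro e h hm
    have hN := pathN_eq (m + 1) e h hm
    rw [pascal]
    have hA : pathP (m + 2) (h + 1) = (h + 2) * chooseP (m + 1) e := by
      cases e with
      | zero => rw [pathP_lt _ _ (by omega)]; simp [chooseP]
      | succ e => rw [ih e (h + 1) (by omega)]; simp [chooseP]
    cases h with
    | zero =>
      rw [pathP_succ_zero, hA]
      linarith
    | succ h =>
      rw [pathP_succ_succ, hA, ih e h (by omega)]
      linarith

/-- the total number of peaks summed over all Dyck words of semilength `n`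
equals `binomial(2n−1, n) = ((n+1)/2)·C_n`. -/
theorem dyck_total_peaks (n : ℕ) (hn : 1 ≤ n) :
    (∑ w : Fin (2 * n) → Bool,
        (if IsDyckWord n w then peaksCount (List.ofFn w) else 0))
      = Nat.choose (2 * n - 1) n ∧
    2 * Nat.choose (2 * n - 1) n = (n + 1) * catalan n := by
  obtain ⟨k, rfl⟩ : ∃ k, n = k + 1 := ⟨n - 1, by omega⟩
  have hs : (2 * k + 1).choose k = (2 * k + 1).choose (k + 1) := by
    rw [← Nat.choose_symm_of_eq_add (show 2 * k + 1 = k + (k + 1) by omega)]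
  have e1 : 2 * (k + 1) - 1 = 2 * k + 1 := by omega
  rw [e1]
  constructor
  · have h := pathP_eq (2 * k) k 0 (by omega)
    rw [zero_add, one_mul, hs] at h
    rw [← h]
    simp only [isDyckWord_iff]
    rfl
  · have h := succ_mul_catalan_eq_centralBinom (k + 1)
    rw [h, Nat.centralBinom, show 2 * (k + 1) = (2 * k + 1) + 1 by ring,
      Nat.choose_succ_succ (2 * k + 1) k, hs]
    simp only [Nat.succ_eq_add_one]
    omega
end

section
/- For all integers n, k ≥ 0 with N := 2n + k ≥ 1, the total number of peaks summed over all words in P_{n,k} satisfies 4N · (total number of peaks) = (N(N+2) − k(k+2)) · C_{n,k}; equivalently, the average number of peaks over P_{n,k} equals (N+2)/4 − k(k+2)/(4N). -/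
open scoped Classical

/-- A word in `P_{n,k}`, encoded as a function `Fin (2n+k) → Bool`
(`true` = U, `false` = D): it has exactly `n` letters D (hence `n+k` letters U) and
every prefix contains at least as many U's as D's. -/
def IsBallot (n k : ℕ) (w : Fin (2 * n + k) → Bool) : Prop :=
  (List.ofFn w).count false = n ∧
  ∀ m ≤ 2 * n + k,
    ((List.ofFn w).take m).count false ≤ ((List.ofFn w).take m).count true

/-- Prefix condition on lists. -/
def BPre (l : List Bool) : Prop :=
  ∀ m ≤ l.length, (l.take m).count false ≤ (l.take m).count true

/-- Weight: indicator of ballot words with `d` letters D. -/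
noncomputable def bwt (l : List Bool) (d : ℕ) : ℤ :=
  if l.count false = d ∧ BPre l then 1 else 0

/-- Indicator that the last letter is U. -/
def lastU (l : List Bool) : ℤ := if l.getLast? = some true then 1 else 0

/-- Sum over all words of length `N`. -/
def wsum (N : ℕ) (f : List Bool → ℤ) : ℤ := ∑ w : Fin N → Bool, f (List.ofFn w)

theorem wsum_zero (f : List Bool → ℤ) : wsum 0 f = f [] := by
  simp [wsum]

theorem wsum_succ (N : ℕ) (f : List Bool → ℤ) :
    wsum (N + 1) f = wsum N (fun l => f (l ++ [true]) + f (l ++ [false])) := by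
  unfold wsum
  rw [← (Fin.snocEquiv (fun _ : Fin (N + 1) => Bool)).sum_comp, Fintype.sum_prod_type,
    Finset.sum_add_distrib]
  have h : ∀ (b : Bool) (w : Fin N → Bool),
      List.ofFn ((Fin.snocEquiv (fun _ : Fin (N + 1) => Bool)) (b, w)) = List.ofFn w ++ [b] := by
    intro b w
    rw [List.ofFn_succ']
    simp [Fin.snocEquiv]
  simp only [h]
  simp

theorem wsum_congr (N : ℕ) (f g : List Bool → ℤ) (h : ∀ l, l.length = N → f l = g l) :
    wsum N f = wsum N g := by
  unfold wsum
  exact Finset.sum_congr rfl (fun w _ => h _ (by simp))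

theorem wsum_add (N : ℕ) (f g : List Bool → ℤ) :
    wsum N (fun l => f l + g l) = wsum N f + wsum N g := by
  simp [wsum, Finset.sum_add_distrib]

theorem count_add (l : List Bool) : l.count false + l.count true = l.length := by
  induction l with
  | nil => rfl
  | cons a l ih => cases a <;> simp <;> omega

theorem BPre_snoc (l : List Bool) (b : Bool) :
    BPre (l ++ [b]) ↔ BPre l ∧ (l ++ [b]).count false ≤ (l ++ [b]).count true := by
  unfold BPre
  constructor
  · intro h
    refine ⟨fun m hm => ?_, ?_⟩
    · have := h m (by simp; omega)
      rwa [List.take_append_of_le_length hm] at this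
    · have := h _ le_rfl
      rwa [List.take_length] at this
  · rintro ⟨h1, h2⟩ m hm
    rcases Nat.lt_or_ge l.length m with h | h
    · rw [List.take_of_length_le (by simp; omega)]
      exact h2
    · rw [List.take_append_of_le_length h]
      exact h1 m h

theorem BPre_self (l : List Bool) (h : BPre l) : l.count false ≤ l.count true := by
  have := h _ le_rfl
  rwa [List.take_length] at this

theorem bwt_true (l : List Bool) (d : ℕ) : bwt (l ++ [true]) d = bwt l d := by
  unfold bwt
  rw [BPre_snoc]
  congr 1
  have := BPre_self l
  simp
  intro _ h
  have := this h
  omega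

theorem bwt_false_zero (l : List Bool) : bwt (l ++ [false]) 0 = 0 := by
  simp [bwt]

theorem bwt_false_succ (l : List Bool) (d : ℕ) (hd : 2 * (d + 1) ≤ l.length + 1) :
    bwt (l ++ [false]) (d + 1) = bwt l d := by
  unfold bwt
  rw [BPre_snoc]
  congr 1
  have := count_add l
  simp
  intro h1 _
  omega

theorem bwt_zero_of_lt (l : List Bool) (d : ℕ) (hd : l.length < 2 * d) : bwt l d = 0 := by
  unfold bwt
  rw [if_neg]
  rintro ⟨h1, h2⟩
  have := count_add l
  have := BPre_self l h2
  omega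

theorem peaks_snoc_true (l : List Bool) : peaksCount (l ++ [true]) = peaksCount l := by
  induction l with
  | nil => rfl
  | cons a l ih =>
    cases l with
    | nil => cases a <;> rfl
    | cons b l =>
      simp only [peaksCount, List.cons_append, List.tail_cons, List.zipWith_cons_cons,
        List.count_cons] at ih ⊢
      omega

theorem peaks_snoc_false (l : List Bool) :
    (peaksCount (l ++ [false]) : ℤ) = peaksCount l + lastU l := by
  induction l with
  | nil => rfl
  | cons a l ih =>
    cases l with
    | nil => cases a <;> rfl
    | cons b l =>
      have h : lastU (a :: b :: l) = lastU (b :: l) := by simp [lastU]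
      rw [h]
      simp only [peaksCount, List.cons_append, List.tail_cons, List.zipWith_cons_cons,
        List.count_cons] at ih ⊢
      push_cast at ih ⊢
      linarith

/-- Number of ballot words. -/
noncomputable def bA (N d : ℕ) : ℤ := wsum N (fun l => bwt l d)
/-- Total number of peaks. -/
noncomputable def bT (N d : ℕ) : ℤ := wsum N (fun l => bwt l d * peaksCount l)
/-- Number of ballot words ending in U. -/
noncomputable def bE (N d : ℕ) : ℤ := wsum N (fun l => bwt l d * lastU l)

theorem wsum_const_zero (N : ℕ) : wsum N (fun _ => 0) = 0 := by simp [wsum]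

theorem bA_zero (N : ℕ) : bA N 0 = 1 := by
  induction N with
  | zero => simp [bA, wsum_zero, bwt, BPre]
  | succ N ih =>
    rw [← ih, bA, wsum_succ]
    simp only [bwt_true, bwt_false_zero, add_zero]
    rfl

theorem bA_lt (N d : ℕ) (h : N < 2 * d) : bA N d = 0 := by
  rw [bA, wsum_congr N _ (fun _ => 0), wsum_const_zero]
  intro l hl
  exact bwt_zero_of_lt l d (by omega)

theorem bT_lt (N d : ℕ) (h : N < 2 * d) : bT N d = 0 := by
  rw [bT, wsum_congr N _ (fun _ => 0), wsum_const_zero]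
  intro l hl
  rw [bwt_zero_of_lt l d (by omega), zero_mul]

theorem bA_succ (N d : ℕ) (h : 2 * (d + 1) ≤ N + 1) :
    bA (N + 1) (d + 1) = bA N (d + 1) + bA N d := by
  unfold bA
  rw [wsum_succ, ← wsum_add]
  apply wsum_congr
  intro l hl
  rw [bwt_true, bwt_false_succ l d (by omega)]

theorem bT_succ (N d : ℕ) (h : 2 * (d + 1) ≤ N + 1) :
    bT (N + 1) (d + 1) = bT N (d + 1) + (bT N d + bE N d) := by
  unfold bT bE
  rw [wsum_succ, ← wsum_add, ← wsum_add]
  apply wsum_congr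
  intro l hl
  rw [bwt_true, bwt_false_succ l d (by omega), peaks_snoc_true, peaks_snoc_false]
  ring

theorem bT_zero (N : ℕ) : bT N 0 = 0 := by
  induction N with
  | zero => simp [bT, wsum_zero, peaksCount]
  | succ N ih =>
    rw [← ih, bT, wsum_succ]
    simp only [bwt_true, bwt_false_zero, add_zero, zero_mul, peaks_snoc_true]
    rfl

theorem bE_succ (N d : ℕ) : bE (N + 1) d = bA N d := by
  unfold bE bA
  rw [wsum_succ]
  apply wsum_congr
  intro l hl
  simp [bwt_true, lastU]

theorem bA_formula (N d : ℕ) (h : 2 * (d + 1) ≤ N + 1) :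
    bA N (d + 1) = (N.choose (d + 1) : ℤ) - N.choose d := by
  induction N generalizing d with
  | zero => omega
  | succ N ih =>
    rcases Nat.lt_or_ge (N + 1) (2 * (d + 1)) with h1 | h1
    · have hN : N + 1 = 2 * d + 1 := by omega
      rw [bA_lt _ _ h1, hN, Nat.choose_symm_half]
      ring
    · rw [bA_succ N d h1, ih d h1]
      cases d with
      | zero => rw [bA_zero]; simp
      | succ d =>
        rw [ih d (by omega), Nat.choose_succ_succ N (d + 1), Nat.choose_succ_succ N d]
        push_cast
        ring

theorem bT_formula (M d : ℕ) (h : 2 * d ≤ M) :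
    bT (M + 1) (d + 1) = ((M : ℤ) - 2 * d) * M.choose d := by
  induction M generalizing d with
  | zero =>
    have hd : d = 0 := by omega
    subst hd
    rw [bT_lt _ _ (by omega)]; simp
  | succ M ih =>
    rcases Nat.lt_or_ge M (2 * d) with h1 | h1
    · rw [bT_lt _ _ (by omega)]
      have : ((M + 1 : ℕ) : ℤ) - 2 * d = 0 := by omega
      rw [this, zero_mul]
    · rw [bT_succ _ _ (by omega), ih d h1, bE_succ]
      cases d with
      | zero => rw [bT_zero, bA_zero]; simp
      | succ d =>
        rw [ih d (by omega), bA_formula M d (by omega), Nat.choose_succ_succ M d]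
        push_cast
        ring

theorem bT_bA (N d : ℕ) (hN : 1 ≤ N) (h : 2 * d ≤ N) :
    (N : ℤ) * bT N d = d * ((N : ℤ) - d + 1) * bA N d := by
  cases d with
  | zero => rw [bT_zero]; simp
  | succ d =>
    obtain ⟨M, rfl⟩ : ∃ M, N = M + 1 := ⟨N - 1, by omega⟩
    rw [bT_formula M d (by omega), bA_formula (M + 1) d (by omega)]
    have h1 : ((M : ℤ) + 1) * M.choose d = (M + 1).choose (d + 1) * (d + 1) := by
      exact_mod_cast Nat.add_one_mul_choose_eq M d
    have h2 : ((M + 1).choose (d + 1) : ℤ) * (d + 1) = (M + 1).choose d * ((M : ℤ) + 1 - d) := by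
      have := Nat.choose_succ_right_eq (M + 1) d
      have h3 : ((M + 1 - d : ℕ) : ℤ) = (M : ℤ) + 1 - d := by omega
      rw [← h3]
      exact_mod_cast this
    push_cast
    linear_combination ((M : ℤ) - 2 * d) * h1 - (d + 1) * h2

theorem bwt_ofFn (n k : ℕ) (w : Fin (2 * n + k) → Bool) :
    bwt (List.ofFn w) n = if IsBallot n k w then 1 else 0 := by
  unfold bwt IsBallot BPre
  rw [List.length_ofFn]
  congr 1

/-- for `N = 2n + k ≥ 1`, the total number of peaks over `P_{n,k}`
satisfies `4N · (total peaks) = (N(N+2) − k(k+2)) · C_{n,k}`, where `C_{n,k} = |P_{n,k}|`;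
equivalently, the average number of peaks over `P_{n,k}` is `(N+2)/4 − k(k+2)/(4N)`. -/
theorem ballot_total_peaks (n k : ℕ) (hN : 1 ≤ 2 * n + k) :
    (4 * (2 * n + k) : ℤ) *
        (∑ w : Fin (2 * n + k) → Bool,
          (if IsBallot n k w then (peaksCount (List.ofFn w) : ℤ) else 0))
      = ((2 * n + k : ℤ) * ((2 * n + k : ℤ) + 2) - (k : ℤ) * ((k : ℤ) + 2)) *
          (Nat.card {w : Fin (2 * n + k) → Bool // IsBallot n k w} : ℤ) := by
  have h := bT_bA (2 * n + k) n hN (by omega)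
  have hT : (∑ w : Fin (2 * n + k) → Bool,
      (if IsBallot n k w then (peaksCount (List.ofFn w) : ℤ) else 0)) = bT (2 * n + k) n := by
    unfold bT wsum
    refine Finset.sum_congr rfl (fun w _ => ?_)
    beta_reduce
    rw [bwt_ofFn]
    split_ifs <;> simp
  have hA : (Nat.card {w : Fin (2 * n + k) → Bool // IsBallot n k w} : ℤ)
      = bA (2 * n + k) n := by
    unfold bA wsum
    simp only [bwt_ofFn]
    rw [Nat.card_eq_fintype_card, Fintype.card_subtype]
    simp
  rw [hT, hA]
  push_cast at h
  linear_combination 4 * h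
end

section
/- For all integers n, k ≥ 0 with N := 2n + k ≥ 1, the total number of peaks and valleys combined, summed over all words in P_{n,k}, satisfies 2(k+1)N · (total number of peaks and valleys) = ((k+1)N² + kN − k²(k+2)) · C_{n,k}; equivalently, the average number of peaks plus valleys over P_{n,k} equals N/2 + k/(2(k+1)) − k²(k+2)/(2(k+1)N). -/
open scoped Classical

namespace BallotAux

/-- Sum of `f` over all words of length `L`. -/
noncomputable def S (L : ℕ) (f : List Bool → ℚ) : ℚ := ∑ w : Fin L → Bool, f (List.ofFn w)

lemma S_zero (f : List Bool → ℚ) : S 0 f = f [] := by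
  simp [S]

lemma S_succ (L : ℕ) (f : List Bool → ℚ) :
    S (L + 1) f = S L (fun l => f (l ++ [true])) + S L (fun l => f (l ++ [false])) := by
  unfold S
  rw [← (Fin.snocEquiv (fun _ : Fin (L + 1) => Bool)).sum_comp, Fintype.sum_prod_type]
  simp [Fin.snocEquiv, List.ofFn_succ', -List.ofFn_succ]

lemma S_add (L : ℕ) (f g : List Bool → ℚ) : S L (fun l => f l + g l) = S L f + S L g := by
  simp [S, Finset.sum_add_distrib]

lemma S_const_zero (L : ℕ) : S L (fun _ => 0) = 0 := by
  simp [S]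

/-- Words with `a` letters U, `b` letters D and all prefixes fine. -/
def Good (a b : ℕ) (l : List Bool) : Prop :=
  l.count true = a ∧ l.count false = b ∧ ∀ p, p <+: l → p.count false ≤ p.count true

noncomputable def ind (a b : ℕ) (l : List Bool) : ℚ := if Good a b l then 1 else 0

lemma ind_zero (a b : ℕ) (h : a < b) (l : List Bool) : ind a b l = 0 := by
  unfold ind
  rw [if_neg]
  rintro ⟨h1, h2, h3⟩
  have := h3 l (List.prefix_refl l)
  omega

lemma ind_true (a b : ℕ) (l : List Bool) : ind (a + 1) b (l ++ [true]) = ind a b l := by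
  unfold ind
  congr 1
  simp only [Good, List.prefix_concat_iff, eq_iff_iff, List.count_append]
  constructor
  · rintro ⟨h1, h2, h3⟩
    simp at h1 h2
    exact ⟨h1, h2, fun p hp => h3 p (Or.inr hp)⟩
  · rintro ⟨h1, h2, h3⟩
    refine ⟨by simp [h1], by simp [h2], ?_⟩
    rintro p (rfl | hp)
    · have := h3 l (List.prefix_refl l)
      simp
      omega
    · exact h3 p hp

lemma ind_true0 (b : ℕ) (l : List Bool) : ind 0 b (l ++ [true]) = 0 := by
  unfold ind
  rw [if_neg]
  rintro ⟨h1, h2, h3⟩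
  simp at h1

lemma ind_false (a b : ℕ) (hab : b + 1 ≤ a) (l : List Bool) :
    ind a (b + 1) (l ++ [false]) = ind a b l := by
  unfold ind
  congr 1
  simp only [Good, List.prefix_concat_iff, eq_iff_iff, List.count_append]
  constructor
  · rintro ⟨h1, h2, h3⟩
    simp at h1 h2
    exact ⟨h1, h2, fun p hp => h3 p (Or.inr hp)⟩
  · rintro ⟨h1, h2, h3⟩
    refine ⟨by simp [h1], by simp [h2], ?_⟩
    rintro p (rfl | hp)
    · simp
      omega
    · exact h3 p hp

lemma ind_false0 (a : ℕ) (l : List Bool) : ind a 0 (l ++ [false]) = 0 := by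
  unfold ind
  rw [if_neg]
  rintro ⟨h1, h2, h3⟩
  simp at h2

def pv (l : List Bool) : ℕ := peaksCount l + valleysCount l

noncomputable def D (l : List Bool) (c : Bool) : ℚ := if l.getLast? = some (!c) then 1 else 0

lemma pv_cons (a b : Bool) (l : List Bool) :
    pv (a :: b :: l) = (if a = b then 0 else 1) + pv (b :: l) := by
  cases a <;> cases b <;> simp [pv, peaksCount, valleysCount] <;> omega

lemma pv_concat (l : List Bool) (c : Bool) : (pv (l ++ [c]) : ℚ) = pv l + D l c := by
  induction l with
  | nil => simp [pv, peaksCount, valleysCount, D]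
  | cons a l ih =>
    cases l with
    | nil => cases a <;> cases c <;> simp [pv, peaksCount, valleysCount, D]
    | cons b t =>
      have hD : D (a :: b :: t) c = D (b :: t) c := by simp [D]
      rw [hD, List.cons_append, List.cons_append, pv_cons, pv_cons]
      rw [List.cons_append] at ih
      push_cast
      rw [ih]
      ring

lemma D_concat (l : List Bool) (x c : Bool) : D (l ++ [x]) c = if x = !c then 1 else 0 := by
  simp [D]

noncomputable def A (L a b : ℕ) : ℚ := S L (ind a b)
noncomputable def T (L a b : ℕ) : ℚ := S L (fun l => ind a b l * pv l)
noncomputable def fA (a b : ℕ) : ℚ :=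
  ((a : ℚ) - b + 1) * (a + b).factorial / ((a + 1).factorial * b.factorial)
noncomputable def fT (a : ℕ) : ℕ → ℚ
  | 0 => 0
  | b + 1 => (2 * (a : ℚ) * (a - b) + a - b - 1) * (a + b).factorial
      / ((a + 1).factorial * b.factorial)

lemma fA_rec (a b : ℕ) : fA (a + 1) (b + 1) = fA a (b + 1) + fA (a + 1) b := by
  unfold fA
  have e1 : a + 1 + (b + 1) = (a + b + 1) + 1 := by ring
  have e2 : a + (b + 1) = (a + b) + 1 := by ring
  have e3 : a + 1 + b = (a + b) + 1 := by ring
  rw [e1, e2, e3]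
  simp only [Nat.factorial_succ]
  push_cast
  have := Nat.factorial_pos a
  have := Nat.factorial_pos b
  field_simp
  ring

lemma fA_zero (a : ℕ) : fA a 0 = 1 := by
  unfold fA
  simp only [add_zero, Nat.factorial_succ]
  push_cast
  have := Nat.factorial_pos a
  field_simp
  simp

lemma fA_diag (a : ℕ) : fA a (a + 1) = 0 := by
  unfold fA
  push_cast
  simp

lemma fT_diag (a : ℕ) : fT a (a + 1) = - fA a a := by
  unfold fA fT
  ring

lemma fT_rec (a b : ℕ) :
    fT (a + 1) (b + 1) = fT a (b + 1) + fT (a + 1) b + 2 * fA a b := by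
  cases b with
  | zero =>
    rw [fA_zero]
    unfold fT
    simp only [add_zero, Nat.factorial_succ]
    push_cast
    have := Nat.factorial_pos a
    field_simp
    ring
  | succ b =>
    simp only [fT, fA]
    have e1 : a + 1 + (b + 1) = (a + b + 1) + 1 := by ring
    have e2 : a + (b + 1) = (a + b) + 1 := by ring
    have e3 : a + 1 + b = (a + b) + 1 := by ring
    rw [e1, e2, e3]
    simp only [Nat.factorial_succ]
    push_cast
    have := Nat.factorial_pos a
    have := Nat.factorial_pos b
    field_simp
    ring

lemma A_lt (L a b : ℕ) (h : a < b) : A L a b = 0 := by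
  simp [A, S, ind_zero a b h]

lemma T_lt (L a b : ℕ) (h : a < b) : T L a b = 0 := by
  simp [T, S, ind_zero a b h]

lemma A_rec (L a b : ℕ) (h : b ≤ a) :
    A (L + 1) (a + 1) (b + 1) = A L a (b + 1) + A L (a + 1) b := by
  unfold A
  rw [S_succ]
  simp only [ind_true, ind_false (a + 1) b (by omega)]

lemma A_rec0 (L a : ℕ) : A (L + 1) (a + 1) 0 = A L a 0 := by
  unfold A
  rw [S_succ]
  simp only [ind_true, ind_false0, S_const_zero, add_zero]

lemma A_eq (L : ℕ) : ∀ a b, a + b = L → b ≤ a → A L a b = fA a b := by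
  induction L with
  | zero =>
    intro a b h _
    obtain ⟨rfl, rfl⟩ : a = 0 ∧ b = 0 := by omega
    simp [A, S_zero, fA, ind, Good]
  | succ L ih =>
    intro a b h hab
    obtain ⟨a, rfl⟩ : ∃ a', a = a' + 1 := ⟨a - 1, by omega⟩
    cases b with
    | zero => rw [A_rec0, ih a 0 (by omega) (by omega), fA_zero, fA_zero]
    | succ b =>
      rw [A_rec _ _ _ (by omega), fA_rec, ih (a + 1) b (by omega) (by omega)]
      by_cases hh : b + 1 ≤ a
      · rw [ih a (b + 1) (by omega) hh]
      · obtain rfl : a = b := by omega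
        rw [A_lt _ _ _ (by omega), fA_diag]

lemma D_true (L a b : ℕ) (h : b + 1 ≤ a) :
    S (L + 1) (fun l => ind a (b + 1) l * D l true) = A L a b := by
  rw [S_succ]
  simp [D_concat, ind_false a b h, S_const_zero, A]

lemma D_true0 (L a : ℕ) :
    S L (fun l => ind a 0 l * D l true) = 0 := by
  cases L with
  | zero => simp [S_zero, D]
  | succ L =>
    rw [S_succ]
    simp [D_concat, ind_false0, S_const_zero]

lemma D_false (L a b : ℕ) :
    S (L + 1) (fun l => ind (a + 1) b l * D l false) = A L a b := by
  rw [S_succ]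
  simp [D_concat, ind_true, S_const_zero, A]

lemma T_rec (L a b : ℕ) (h : b ≤ a) :
    T (L + 1) (a + 1) (b + 1) = T L a (b + 1) + S L (fun l => ind a (b + 1) l * D l true)
      + (T L (a + 1) b + S L (fun l => ind (a + 1) b l * D l false)) := by
  unfold T
  rw [S_succ]
  simp only [ind_true, ind_false (a + 1) b (by omega), pv_concat, mul_add, S_add]

lemma T_rec0 (L a : ℕ) : T (L + 1) (a + 1) 0 = T L a 0 := by
  unfold T
  rw [S_succ]
  simp only [ind_true, ind_false0, pv_concat, mul_add, S_add, zero_mul, S_const_zero, add_zero,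
    D_true0]

lemma T_eq (L : ℕ) : ∀ a b, a + b = L → b ≤ a → T L a b = fT a b := by
  induction L with
  | zero =>
    intro a b h _
    obtain ⟨rfl, rfl⟩ : a = 0 ∧ b = 0 := by omega
    simp [T, S_zero, fT, pv, peaksCount, valleysCount]
  | succ L ih =>
    intro a b h hab
    obtain ⟨a, rfl⟩ : ∃ a', a = a' + 1 := ⟨a - 1, by omega⟩
    cases b with
    | zero => rw [T_rec0, ih a 0 (by omega) (by omega), fT, fT]
    | succ b =>
      rw [T_rec _ _ _ (by omega), fT_rec, ih (a + 1) b (by omega) (by omega)]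
      obtain ⟨L, rfl⟩ : ∃ M, L = M + 1 := ⟨L - 1, by omega⟩
      rw [D_false, A_eq L a b (by omega) (by omega)]
      by_cases hh : b + 1 ≤ a
      · rw [ih a (b + 1) (by omega) hh, D_true _ _ _ hh, A_eq L a b (by omega) (by omega)]
        ring
      · obtain rfl : a = b := by omega
        rw [T_lt _ _ _ (by omega), fT_diag]
        have : ∀ l, ind a (a + 1) l = 0 := ind_zero _ _ (by omega)
        simp only [this, zero_mul, S_const_zero]
        ring

lemma count_tf (l : List Bool) : l.count true + l.count false = l.length := by
  induction l with
  | nil => simp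
  | cons a l ih => cases a <;> simp <;> omega

lemma isBallot_iff (n k : ℕ) (w : Fin (2 * n + k) → Bool) :
    IsBallot n k w ↔ Good (n + k) n (List.ofFn w) := by
  have h := count_tf (List.ofFn w)
  rw [List.length_ofFn] at h
  unfold IsBallot Good
  constructor
  · rintro ⟨h1, h2⟩
    refine ⟨by omega, h1, fun p hp => ?_⟩
    rw [List.prefix_iff_eq_take] at hp
    by_cases hm : p.length ≤ 2 * n + k
    · have := h2 _ hm
      rwa [← hp] at this
    · have h3 := congrArg List.length hp
      simp at h3
      omega
  · rintro ⟨h1, h2, h3⟩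
    exact ⟨h2, fun m _ => h3 _ (List.take_prefix _ _)⟩

lemma final (n k : ℕ) :
    (2 * ((k : ℚ) + 1) * (2 * n + k)) * fT (n + k) n =
      (((k : ℚ) + 1) * (2 * n + k) ^ 2 + k * (2 * n + k) - (k : ℚ) ^ 2 * (k + 2))
        * fA (n + k) n := by
  cases n with
  | zero =>
    simp only [fT]
    push_cast
    ring
  | succ b =>
    simp only [fT, fA]
    have e1 : b + 1 + k + (b + 1) = (b + 1 + k + b) + 1 := by ring
    rw [e1]
    simp only [Nat.factorial_succ]
    push_cast
    have := Nat.factorial_pos b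
    have := Nat.factorial_pos (b + 1 + k)
    field_simp
    ring

end BallotAux

/-- for `N = 2n + k ≥ 1`, the total number of peaks and valleys combined
over `P_{n,k}` satisfies
`2(k+1)N · (total) = ((k+1)N² + kN − k²(k+2)) · C_{n,k}`, where `C_{n,k} = |P_{n,k}|`;
equivalently, the average number of peaks plus valleys over `P_{n,k}` equals
`N/2 + k/(2(k+1)) − k²(k+2)/(2(k+1)N)`. -/
theorem ballot_total_peaks_valleys (n k : ℕ) (hN : 1 ≤ 2 * n + k) :
    (2 * ((k : ℤ) + 1) * (2 * n + k : ℤ)) *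
        (∑ w : Fin (2 * n + k) → Bool,
          (if IsBallot n k w then
            ((peaksCount (List.ofFn w) + valleysCount (List.ofFn w) : ℕ) : ℤ) else 0))
      = (((k : ℤ) + 1) * (2 * n + k : ℤ) ^ 2 + (k : ℤ) * (2 * n + k : ℤ)
            - (k : ℤ) ^ 2 * ((k : ℤ) + 2)) *
          (Nat.card {w : Fin (2 * n + k) → Bool // IsBallot n k w} : ℤ) := by
  have hA : (Nat.card {w : Fin (2 * n + k) → Bool // IsBallot n k w} : ℚ)
      = BallotAux.fA (n + k) n := by
    rw [← BallotAux.A_eq (2 * n + k) (n + k) n (by omega) (by omega), Nat.card_eq_fintype_card,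
      Fintype.card_subtype, Finset.card_filter]
    push_cast
    unfold BallotAux.A BallotAux.S BallotAux.ind
    simp only [BallotAux.isBallot_iff]
  have hT : (∑ w : Fin (2 * n + k) → Bool,
          (if IsBallot n k w then
            ((peaksCount (List.ofFn w) + valleysCount (List.ofFn w) : ℕ) : ℚ) else 0))
      = BallotAux.fT (n + k) n := by
    rw [← BallotAux.T_eq (2 * n + k) (n + k) n (by omega) (by omega)]
    unfold BallotAux.T BallotAux.S BallotAux.ind
    simp only [BallotAux.isBallot_iff, ite_mul, one_mul, zero_mul]
    rfl
  have h := BallotAux.final n k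
  rw [← hA, ← hT] at h
  have hc : ∀ x y : ℤ, (x : ℚ) = y → x = y := fun x y h => by exact_mod_cast h
  apply hc
  push_cast at h ⊢
  exact h
end

section
/- For all integers s ≥ 1 and n ≥ 1, the total number of peaks plus monochromatic valleys, summed over all s-colored Dyck words of semilength n, satisfies 2s · (total count) = ((s+1)n + (s−1)) · s^n · C_n. -/
open scoped Classical

/-- The height of the length-`m` prefix of a `{U,D}`-word: number of U's minus number
of D's. -/
def ht (l : List Bool) (m : ℕ) : ℤ :=
  (((l.take m).count true : ℤ)) - (((l.take m).count false : ℤ))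

/-- Position `j` holds the letter D matched with the letter U at position `i`:
`j` is the first later position where the height returns to its value just before
position `i`. -/
def IsMatch (l : List Bool) (i j : ℕ) : Prop :=
  i < j ∧ j < l.length ∧ l.getD i false = true ∧ l.getD j true = false ∧
  ht l (j + 1) = ht l i ∧ ∀ m : ℕ, i < m → m ≤ j → ht l i < ht l m

/-- An `s`-colored Dyck word of semilength `n`: each letter carries one of `s` colors,
the underlying `{U,D}`-word is a Dyck word, and matched letters carry the same color. -/
def IsColoredDyck (s n : ℕ) (w : Fin (2 * n) → Bool × Fin s) : Prop :=
  IsDyckWord n (fun i => (w i).1) ∧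
  ∀ i j : Fin (2 * n),
    IsMatch (List.ofFn (fun p => (w p).1)) (i : ℕ) (j : ℕ) → (w i).2 = (w j).2

/-- The number of monochromatic valleys of a colored word: indices `i` with
`w_i = D`, `w_{i+1} = U` and the colors at positions `i` and `i+1` equal
(a position's color is the color of its matched pair). -/
def monoValleysCount {s : ℕ} (l : List (Bool × Fin s)) : ℕ :=
  (List.zipWith (fun a b => !a.1 && b.1 && decide (a.2 = b.2)) l l.tail).count true


/-- Binary trees with labelled nodes. -/
inductive CTree (α : Type) : Type
  | nil : CTree α
  | node : α → CTree α → CTree α → CTree α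

namespace CTree

variable {α : Type}

/-- Number of nodes. -/
def size : CTree α → ℕ
  | nil => 0
  | node _ l r => size l + size r + 1

/-- The colored Dyck word of a tree. -/
def enc : CTree α → List (Bool × α)
  | nil => []
  | node c l r => (true, c) :: (enc l ++ (false, c) :: enc r)

/-- Indicator of the empty tree. -/
def nu : CTree α → ℕ
  | nil => 1
  | node _ _ _ => 0

/-- Indicator that the root has label `c`. -/
noncomputable def rho (c : α) : CTree α → ℕ
  | nil => 0
  | node d _ _ => if c = d then 1 else 0

/-- Peaks plus monochromatic valleys. -/
noncomputable def st : CTree α → ℕ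
  | nil => 0
  | node c l r => nu l + st l + st r + rho c r

theorem length_enc (t : CTree α) : (enc t).length = 2 * size t := by
  induction t with
  | nil => rfl
  | node c l r ihl ihr => simp [enc, size, ihl, ihr]; ring

theorem enc_inj_aux (t : CTree α) : ∀ (t' : CTree α) (r1 r2 : List (Bool × α)),
    (∀ c r', r1 ≠ (true, c) :: r') → (∀ c r', r2 ≠ (true, c) :: r') →
    enc t ++ r1 = enc t' ++ r2 → t = t' ∧ r1 = r2 := by
  induction t with
  | nil =>
    intro t' r1 r2 h1 h2 h
    cases t' with
    | nil => exact ⟨rfl, by simpa [enc] using h⟩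
    | node c l r => exact absurd (by simpa [enc] using h) (h1 c _)
  | node c l r ihl ihr =>
    intro t' r1 r2 h1 h2 h
    cases t' with
    | nil => exact absurd (by simpa [enc] using h.symm) (h2 c _)
    | node c' l' r' =>
      simp only [enc, List.cons_append, List.append_assoc, List.cons.injEq, Prod.mk.injEq,
        true_and] at h
      obtain ⟨rfl, h⟩ := h
      obtain ⟨rfl, hh⟩ := ihl l' _ _ (by simp) (by simp) h
      replace h := (List.cons.inj hh).2
      obtain ⟨rfl, h3⟩ := ihr r' _ _ h1 h2 h
      exact ⟨rfl, h3⟩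

theorem enc_inj {t t' : CTree α} (h : enc t = enc t') : t = t' :=
  (enc_inj_aux t t' [] [] (by simp) (by simp) (by simpa using h)).1

/-- All trees with `n` nodes. -/
noncomputable def trees (α : Type) [Fintype α] : ℕ → Finset (CTree α)
  | 0 => {nil}
  | n + 1 => (Finset.HasAntidiagonal.antidiagonal n).attach.biUnion fun ij =>
      ((Finset.univ : Finset α) ×ˢ (trees α ij.1.1 ×ˢ trees α ij.1.2)).image
        fun p => node p.1 p.2.1 p.2.2
  decreasing_by
    · have := Finset.HasAntidiagonal.mem_antidiagonal.1 ij.2; omega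
    · have := Finset.HasAntidiagonal.mem_antidiagonal.1 ij.2; omega

theorem mem_trees [Fintype α] (t : CTree α) : ∀ n, t ∈ trees α n ↔ size t = n := by
  induction t with
  | nil => 
    intro n
    cases n with
    | zero => simp [trees, size]
    | succ n => simp [trees, size]
  | node c l r ihl ihr =>
    intro n
    cases n with
    | zero => simp [trees, size]
    | succ n => simp [trees, size, ihl, ihr]

theorem sum_trees_succ [Fintype α] (n : ℕ) (f : CTree α → ℕ) :
    ∑ t ∈ trees α (n + 1), f t = ∑ ij ∈ Finset.HasAntidiagonal.antidiagonal n,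
      ∑ c : α, ∑ l ∈ trees α ij.1, ∑ r ∈ trees α ij.2, f (node c l r) := by
  rw [trees, Finset.sum_biUnion]
  · rw [← Finset.sum_attach (Finset.HasAntidiagonal.antidiagonal n)]
    refine Finset.sum_congr rfl fun ij _ => ?_
    rw [Finset.sum_image, Finset.sum_product]
    · refine Finset.sum_congr rfl fun c _ => ?_
      rw [Finset.sum_product]
    · rintro ⟨a, b, c⟩ _ ⟨a', b', c'⟩ _ h
      simpa using h
  · rintro ⟨⟨i, j⟩, h⟩ _ ⟨⟨i', j'⟩, h'⟩ _ hne
    rw [Function.onFun, Finset.disjoint_left]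
    intro t ht ht'
    simp only [Finset.mem_image, Finset.mem_product, mem_trees, Prod.exists] at ht ht'
    obtain ⟨c, l, r, ⟨_, h1, h2⟩, rfl⟩ := ht
    obtain ⟨c', l', r', ⟨_, h3, h4⟩, h5⟩ := ht'
    simp only [node.injEq] at h5
    obtain ⟨rfl, rfl, rfl⟩ := h5
    subst h1 h2 h3 h4
    exact hne rfl

theorem card_trees [Fintype α] (n : ℕ) :
    (trees α n).card = Fintype.card α ^ n * catalan n := by
  induction n using Nat.strong_induction_on with
  | _ n ih =>
    cases n with
    | zero => simp [trees]
    | succ n =>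
      rw [Finset.card_eq_sum_ones, sum_trees_succ, catalan_succ', Finset.mul_sum]
      refine Finset.sum_congr rfl fun ij hij => ?_
      have := Finset.HasAntidiagonal.mem_antidiagonal.1 hij
      simp only [Finset.sum_const, smul_eq_mul, mul_one, Finset.card_univ]
      rw [ih ij.1 (by omega), ih ij.2 (by omega), ← this]
      ring

theorem sum_nu [Fintype α] (n : ℕ) : ∑ t ∈ trees α n, nu t = if n = 0 then 1 else 0 := by
  cases n with
  | zero => simp [trees, nu]
  | succ n => simp [sum_trees_succ, nu]

theorem sum_rho [Fintype α] (t : CTree α) : (∑ c, rho c t) + nu t = 1 := by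
  cases t <;> simp [rho, nu]

theorem sum_st_succ [Fintype α] (n : ℕ) :
    (∑ t ∈ trees α (n + 1), st t) + (trees α n).card =
    ∑ ij ∈ Finset.HasAntidiagonal.antidiagonal n, (
      Fintype.card α * (trees α ij.1).card * (∑ t ∈ trees α ij.2, st t)
      + Fintype.card α * (∑ t ∈ trees α ij.1, st t) * (trees α ij.2).card
      + (trees α ij.1).card * (trees α ij.2).card)
      + Fintype.card α * (trees α n).card := by
  have key : ∀ i j, (∑ c : α, ∑ l ∈ trees α i, ∑ r ∈ trees α j, st (node c l r))
      + (trees α i).card * (if j = 0 then 1 else 0) = 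
      Fintype.card α * (trees α i).card * (∑ t ∈ trees α j, st t)
      + Fintype.card α * (∑ t ∈ trees α i, st t) * (trees α j).card
      + (trees α i).card * (trees α j).card
      + Fintype.card α * (if i = 0 then 1 else 0) * (trees α j).card := by
    intro i j
    have hr : (∑ c : α, ∑ r ∈ trees α j, rho c r) + (if j = 0 then 1 else 0)
        = (trees α j).card := by
      rw [Finset.sum_comm, ← sum_nu (α := α) j, ← Finset.sum_add_distrib,
        Finset.card_eq_sum_ones]
      exact Finset.sum_congr rfl fun t _ => sum_rho t
    rw [← sum_nu (α := α) i]
    simp only [st, Finset.sum_add_distrib, Finset.sum_const, smul_eq_mul, Finset.card_univ,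
      ← Finset.mul_sum]
    rw [← hr]
    ring
  have e1 : ∑ ij ∈ Finset.HasAntidiagonal.antidiagonal n, (trees α ij.1).card * (if ij.2 = 0 then 1 else 0)
      = (trees α n).card := by
    rw [Finset.sum_eq_single (n, 0)]
    · simp
    · rintro ⟨i, j⟩ h hne
      have := Finset.HasAntidiagonal.mem_antidiagonal.1 h
      have : j ≠ 0 := by rintro rfl; simp_all
      simp [this]
    · simp
  have e2 : ∑ ij ∈ Finset.HasAntidiagonal.antidiagonal n,
      Fintype.card α * (if ij.1 = 0 then 1 else 0) * (trees α ij.2).card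
      = Fintype.card α * (trees α n).card := by
    rw [Finset.sum_eq_single (0, n)]
    · simp
    · rintro ⟨i, j⟩ h hne
      have := Finset.HasAntidiagonal.mem_antidiagonal.1 h
      have : i ≠ 0 := by rintro rfl; simp_all
      simp [this]
    · simp
  rw [sum_trees_succ, ← e2, ← Finset.sum_add_distrib]
  conv_lhs => rw [← e1]
  rw [← Finset.sum_add_distrib]
  exact Finset.sum_congr rfl fun ij _ => key _ _

theorem catalan_moment (n : ℕ) :
    2 * ∑ ij ∈ Finset.HasAntidiagonal.antidiagonal n, (ij.1 : ℤ) * (catalan ij.1 * catalan ij.2)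
      = n * catalan (n + 1) := by
  have h : ∑ ij ∈ Finset.HasAntidiagonal.antidiagonal n, (ij.1 : ℤ) * (catalan ij.1 * catalan ij.2)
      = ∑ ij ∈ Finset.HasAntidiagonal.antidiagonal n, (ij.2 : ℤ) * (catalan ij.1 * catalan ij.2) := by
    rw [← Finset.Nat.sum_antidiagonal_swap]
    refine Finset.sum_congr rfl fun ij _ => ?_
    simp only [Prod.fst_swap, Prod.snd_swap]; ring
  rw [two_mul]
  nth_rw 2 [h]
  rw [← Finset.sum_add_distrib, catalan_succ']
  push_cast
  rw [Finset.mul_sum]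
  refine Finset.sum_congr rfl fun ij hij => ?_
  rw [← Finset.HasAntidiagonal.mem_antidiagonal.1 hij]
  push_cast; ring

theorem sum_st [Fintype α] (n : ℕ) :
    2 * (Fintype.card α : ℤ) * (∑ t ∈ trees α n, st t : ℕ) =
      (((Fintype.card α : ℤ) + 1) * n + (Fintype.card α - 1)) * Fintype.card α ^ n * catalan n
        - (if n = 0 then (Fintype.card α : ℤ) - 1 else 0) := by
  induction n using Nat.strong_induction_on with
  | _ n ih =>
    cases n with
    | zero => simp [trees, st]
    | succ n =>
      have h := sum_st_succ (α := α) n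
      have hm := catalan_moment n
      have hc : (catalan (n + 1) : ℤ) = ∑ ij ∈ Finset.HasAntidiagonal.antidiagonal n,
        (catalan ij.1 : ℤ) * catalan ij.2 := by rw [catalan_succ']; push_cast; rfl
      simp only [card_trees] at h
      generalize Fintype.card α = s at *
      -- the symmetrised recursion
      have hsw : ∑ ij ∈ Finset.HasAntidiagonal.antidiagonal n,
          (s * (s ^ ij.1 * catalan ij.1) * (∑ t ∈ trees α ij.2, st t) : ℕ)
          = ∑ ij ∈ Finset.HasAntidiagonal.antidiagonal n,
          (s * (∑ t ∈ trees α ij.1, st t) * (s ^ ij.2 * catalan ij.2)) := by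
        rw [← Finset.Nat.sum_antidiagonal_swap]
        refine Finset.sum_congr rfl fun ij _ => ?_
        simp only [Prod.fst_swap, Prod.snd_swap]; ring
      rw [Finset.sum_add_distrib, Finset.sum_add_distrib, hsw] at h
      have h3 : ∑ ij ∈ Finset.HasAntidiagonal.antidiagonal n, s ^ ij.1 * catalan ij.1 * (s ^ ij.2 * catalan ij.2)
          = s ^ n * catalan (n + 1) := by
        rw [catalan_succ', Finset.mul_sum]
        refine Finset.sum_congr rfl fun ij hij => ?_
        rw [← Finset.HasAntidiagonal.mem_antidiagonal.1 hij]; ring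
      rw [h3] at h
      have h4 : 2 * (s : ℤ) * (∑ ij ∈ Finset.HasAntidiagonal.antidiagonal n,
          (s * (∑ t ∈ trees α ij.1, st t) * (s ^ ij.2 * catalan ij.2)) : ℕ)
          = s ^ (n + 1) * ((s + 1) * (∑ ij ∈ Finset.HasAntidiagonal.antidiagonal n,
              (ij.1 : ℤ) * (catalan ij.1 * catalan ij.2))
            + (s - 1) * catalan (n + 1)) - (s - 1) * s ^ (n + 1) * catalan n := by
        have h5 : ∀ ij ∈ Finset.HasAntidiagonal.antidiagonal n,
            2 * (s : ℤ) * (s * (∑ t ∈ trees α ij.1, st t) * (s ^ ij.2 * catalan ij.2) : ℕ)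
            = s ^ (n + 1) * ((s + 1) * ((ij.1 : ℤ) * (catalan ij.1 * catalan ij.2))
              + (s - 1) * (catalan ij.1 * catalan ij.2))
              - (if ij.1 = 0 then (s : ℤ) - 1 else 0) * (s * (s ^ ij.2 * catalan ij.2)) := by
          intro ij hij
          have hn := Finset.HasAntidiagonal.mem_antidiagonal.1 hij
          have := ih ij.1 (by omega)
          calc _ = (2 * (s : ℤ) * (∑ t ∈ trees α ij.1, st t : ℕ))
                * (s * (s ^ ij.2 * catalan ij.2)) := by push_cast; ring
            _ = _ := by rw [this, ← hn]; ring
        rw [Nat.cast_sum, Finset.mul_sum, Finset.sum_congr rfl h5, Finset.sum_sub_distrib,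
          ← Finset.mul_sum, Finset.sum_add_distrib, ← Finset.mul_sum, ← Finset.mul_sum, ← hc]
        congr 1
        rw [Finset.sum_eq_single (0, n)]
        · simp; ring
        · rintro ⟨i, j⟩ h hne
          have := Finset.HasAntidiagonal.mem_antidiagonal.1 h
          have : i ≠ 0 := by rintro rfl; simp_all
          simp [this]
        · simp
      have h' := congrArg (Nat.cast : ℕ → ℤ) h
      rw [Nat.cast_add, Nat.cast_add, Nat.cast_add, Nat.cast_add] at h'
      generalize (Nat.cast (∑ ij ∈ Finset.HasAntidiagonal.antidiagonal n,
          (s * (∑ t ∈ trees α ij.1, st t) * (s ^ ij.2 * catalan ij.2))) : ℤ) = X at *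
      generalize (Nat.cast (∑ t ∈ trees α (n + 1), st t) : ℤ) = Y at *
      generalize (∑ ij ∈ Finset.HasAntidiagonal.antidiagonal n,
              (ij.1 : ℤ) * (catalan ij.1 * catalan ij.2)) = Z at *
      push_cast at h' ⊢
      rw [sub_zero]
      linear_combination 2 * (s : ℤ) * h' + 2 * h4 + (s : ℤ) ^ (n + 1) * (s + 1) * hm

end CTree

/-! ### Heights -/

theorem ht_zero (l : List Bool) : ht l 0 = 0 := by simp [ht]

theorem ht_nil (m : ℕ) : ht [] m = 0 := by simp [ht]

theorem ht_cons (x : Bool) (l : List Bool) (m : ℕ) :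
    ht (x :: l) (m + 1) = (if x then 1 else -1) + ht l m := by
  cases x <;> simp [ht, List.count_cons] <;> ring

theorem ht_of_length_le (l : List Bool) (m : ℕ) (h : l.length ≤ m) : ht l m = ht l l.length := by
  simp [ht, List.take_of_length_le h]

theorem ht_append_left (a b : List Bool) (m : ℕ) (h : m ≤ a.length) :
    ht (a ++ b) m = ht a m := by
  simp [ht, List.take_append_of_le_length h]

theorem ht_append_right (a b : List Bool) (m : ℕ) :
    ht (a ++ b) (a.length + m) = ht a a.length + ht b m := by
  simp [ht, List.take_append, List.take_of_length_le (Nat.le_add_right a.length m)]; ring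

theorem isMatch_embed (a b c : List Bool) (i j : ℕ) (hj : j < b.length) :
    IsMatch (a ++ (b ++ c)) (a.length + i) (a.length + j) ↔ IsMatch b i j := by
  have hh : ∀ m, m ≤ b.length → ht (a ++ (b ++ c)) (a.length + m) = ht a a.length + ht b m := by
    intro m hm
    rw [ht_append_right, ht_append_left b c m hm]
  have hg : ∀ k d, k < b.length → (a ++ (b ++ c)).getD (a.length + k) d = b.getD k d := by
    intro k d hk
    rw [List.getD_append_right _ _ _ _ (by omega), Nat.add_sub_cancel_left,
      List.getD_append _ _ _ _ hk]
  unfold IsMatch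
  constructor
  · rintro ⟨h1, h2, h3, h4, h5, h6⟩
    rw [hg _ _ (by omega)] at h3
    rw [hg _ _ (by omega)] at h4
    rw [add_assoc, hh _ (by omega), hh _ (by omega)] at h5
    refine ⟨by omega, hj, h3, h4, by omega, fun m hm1 hm2 => ?_⟩
    have := h6 (a.length + m) (by omega) (by omega)
    rw [hh _ (by omega), hh _ (by omega)] at this
    omega
  · rintro ⟨h1, h2, h3, h4, h5, h6⟩
    refine ⟨by omega, by simp; omega, ?_, ?_, ?_, fun m hm1 hm2 => ?_⟩
    · rwa [hg _ _ (by omega)]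
    · rwa [hg _ _ (by omega)]
    · rw [add_assoc, hh _ (by omega), hh _ (by omega)]; omega
    · obtain ⟨k, rfl⟩ : ∃ k, m = a.length + k := ⟨m - a.length, by omega⟩
      rw [hh _ (by omega), hh _ (by omega)]
      have := h6 k (by omega) (by omega)
      omega

/-- Colored Dyck words as lists. -/
def CD {α : Type} (l : List (Bool × α)) : Prop :=
  ht (l.map Prod.fst) l.length = 0 ∧ (∀ m, 0 ≤ ht (l.map Prod.fst) m) ∧
  ∀ i j, IsMatch (l.map Prod.fst) i j → (l.map Prod.snd)[i]? = (l.map Prod.snd)[j]?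

theorem CD_node {α : Type} (c d : α) (a b : List (Bool × α)) :
    CD ((true, c) :: (a ++ (false, d) :: b)) ∧ ht (a.map Prod.fst) a.length = 0 ∧
      (∀ m, 0 ≤ ht (a.map Prod.fst) m) ↔ (CD a ∧ CD b ∧ c = d) := by
  set A := a.map Prod.fst with hA
  set B := b.map Prod.fst with hB
  have hAl : A.length = a.length := by simp [hA]
  have hBl : B.length = b.length := by simp [hB]
  have hW : ((true, c) :: (a ++ (false, d) :: b)).map Prod.fst = true :: (A ++ false :: B) := by
    simp [hA, hB]
  have hWS : ((true, c) :: (a ++ (false, d) :: b)).map Prod.snd =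
      c :: (a.map Prod.snd ++ d :: b.map Prod.snd) := by simp
  have hl : ((true, c) :: (a ++ (false, d) :: b)).length = a.length + (b.length + 1) + 1 := by
    simp
  -- heights
  have h1 : ∀ m, m ≤ a.length → ht (true :: (A ++ false :: B)) (m + 1) = 1 + ht A m := by
    intro m hm
    rw [ht_cons, ht_append_left _ _ _ (by omega)]; simp
  have h2 : ∀ m, ht (true :: (A ++ false :: B)) (a.length + (m + 1) + 1)
      = ht A a.length + ht B m := by
    intro m
    rw [ht_cons, ← hAl, ht_append_right, ht_cons]; simp; ring
  have eA : ∀ i j, j < a.length →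
      (IsMatch (true :: (A ++ false :: B)) (i + 1) (j + 1) ↔ IsMatch A i j) := by
    intro i j hj
    have := isMatch_embed [true] A (false :: B) i j (by omega)
    simpa [add_comm] using this
  have eB : ∀ i j, j < b.length →
      (IsMatch (true :: (A ++ false :: B)) (a.length + i + 2) (a.length + j + 2)
        ↔ IsMatch B i j) := by
    intro i j hj
    have := isMatch_embed (true :: (A ++ [false])) B [] i j (by omega)
    simp only [List.length_cons, List.length_append, List.length_nil, hAl, List.append_nil,
      List.cons_append, List.append_assoc, List.nil_append] at this
    rw [← this]
    constructor <;> intro h <;> convert h using 1 <;> ring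
  have sA : ∀ i, i < a.length → (c :: (a.map Prod.snd ++ d :: b.map Prod.snd))[i + 1]?
      = (a.map Prod.snd)[i]? := by
    intro i hi
    rw [List.getElem?_cons_succ, List.getElem?_append_left (by simpa using hi)]
  have sD : (c :: (a.map Prod.snd ++ d :: b.map Prod.snd))[a.length + 1]? = some d := by
    rw [List.getElem?_cons_succ, List.getElem?_append_right (by simp)]
    simp
  have sB : ∀ i, (c :: (a.map Prod.snd ++ d :: b.map Prod.snd))[a.length + i + 2]?
      = (b.map Prod.snd)[i]? := by
    intro i
    rw [List.getElem?_cons_succ, List.getElem?_append_right (by simp; omega)]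
    simp only [List.length_map]
    rw [show a.length + i + 1 - a.length = i + 1 by omega, List.getElem?_cons_succ]
  have gD : (true :: (A ++ false :: B)).getD (a.length + 1) true = false := by
    rw [List.getD_cons_succ, List.getD_append_right _ _ _ _ (by omega)]; simp [hAl]
  have gD' : (true :: (A ++ false :: B)).getD (a.length + 1) false = false := by
    rw [List.getD_cons_succ, List.getD_append_right _ _ _ _ (by omega)]; simp [hAl]
  have hWl : (true :: (A ++ false :: B)).length = a.length + b.length + 2 := by
    simp [hAl, hBl]; ring
  unfold CD
  rw [hW, hWS, hl, ← hA, ← hB]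
  constructor
  · rintro ⟨⟨w1, w2, w3⟩, a1, a2⟩
    refine ⟨⟨a1, a2, fun i j hm => ?_⟩, ⟨?_, fun m => ?_, fun i j hm => ?_⟩, ?_⟩
    · have hj := hm.2.1
      have hi := hm.1
      have := w3 (i + 1) (j + 1) ((eA i j (by omega)).2 hm)
      rwa [sA _ (by omega), sA _ (by omega)] at this
    · rw [h2] at w1; omega
    · have := w2 (a.length + (m + 1) + 1)
      rw [h2] at this; omega
    · have hj := hm.2.1
      have := w3 _ _ ((eB i j (by omega)).2 hm)
      rwa [sB, sB] at this
    · have := w3 0 (a.length + 1) ⟨by omega, by omega, by simp, gD, ?_, fun m hm1 hm2 => ?_⟩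
      · rw [sD] at this; simpa using this
      · have := h2 0
        rw [zero_add] at this
        rw [this, ht_zero, ht_zero, a1]; rfl
      · obtain ⟨k, rfl⟩ : ∃ k, m = k + 1 := ⟨m - 1, by omega⟩
        rw [h1 k (by omega), ht_zero]
        have := a2 k
        omega
  · rintro ⟨⟨a1, a2, a3⟩, ⟨b1, b2, b3⟩, rfl⟩
    refine ⟨⟨?_, fun m => ?_, fun i j hm => ?_⟩, a1, a2⟩
    · rw [h2]; omega
    · rcases Nat.eq_zero_or_pos m with rfl | hm
      · rw [ht_zero]
      · rcases Nat.lt_or_ge (a.length + 1) m with h | h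
        · obtain ⟨k, rfl⟩ : ∃ k, m = a.length + (k + 1) + 1 := ⟨m - a.length - 2, by omega⟩
          rw [h2]; have := b2 k; omega
        · obtain ⟨k, rfl⟩ : ∃ k, m = k + 1 := ⟨m - 1, by omega⟩
          rw [h1 _ (by omega)]; have := a2 k; omega
    · have hm' := hm
      obtain ⟨m1, m2, m3, m4, m5, m6⟩ := hm
      have hz : ht (true :: (A ++ false :: B)) (a.length + 2) = 0 := by
        have := h2 0
        rw [zero_add] at this
        rw [this, ht_zero, a1]; rfl
      rcases Nat.lt_or_ge (a.length + 1) i with hi | hi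
      · obtain ⟨i', rfl⟩ : ∃ k, i = a.length + k + 2 := ⟨i - a.length - 2, by omega⟩
        obtain ⟨j', rfl⟩ : ∃ k, j = a.length + k + 2 := ⟨j - a.length - 2, by omega⟩
        rw [sB, sB]
        exact b3 _ _ ((eB _ _ (by omega)).1 hm')
      · rcases Nat.eq_zero_or_pos i with rfl | hi0
        · have : j = a.length + 1 := by
            rw [ht_zero] at m5 m6
            rcases lt_trichotomy j (a.length + 1) with h | h | h
            · rw [h1 j (by omega)] at m5
              have := a2 j; omega
            · exact h
            · have := m6 (a.length + 2) (by omega) (by omega)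
              omega
          subst this
          rw [sD]; simp
        · obtain ⟨i', rfl⟩ : ∃ k, i = k + 1 := ⟨i - 1, by omega⟩
          have hi' : i' ≠ a.length := by
            rintro rfl
            rw [gD'] at m3; simp at m3
          obtain ⟨j', rfl⟩ : ∃ k, j = k + 1 := ⟨j - 1, by omega⟩
          have hia := a2 i'
          have hii := h1 i' (by omega)
          have hj1 : j' < a.length := by
            by_contra hcon
            rcases Nat.lt_or_ge a.length j' with h | h
            · have := m6 (a.length + 2) (by omega) (by omega)
              omega
            · have : j' = a.length := by omega
              subst this
              have : ht (true :: (A ++ false :: B)) (a.length + 1 + 1) = 0 := hz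
              omega
          rw [sA _ (by omega), sA _ hj1]
          exact a3 _ _ ((eA _ _ hj1).1 hm')

theorem CD_nil {α : Type} : CD ([] : List (Bool × α)) := by
  refine ⟨by simp [ht], by simp [ht], fun i j h => by simp⟩

theorem CD_enc {α : Type} (t : CTree α) : CD t.enc := by
  induction t with
  | nil => exact CD_nil
  | node c l r ihl ihr => exact ((CD_node c c l.enc r.enc).2 ⟨ihl, ihr, rfl⟩).1

theorem exists_decomp {α : Type} (l : List (Bool × α)) (h : CD l) (hl : l ≠ []) :
    ∃ c d a b, l = (true, c) :: (a ++ (false, d) :: b) ∧ ht (a.map Prod.fst) a.length = 0 ∧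
      (∀ m, 0 ≤ ht (a.map Prod.fst) m) := by
  obtain ⟨w1, w2, w3⟩ := h
  have hpos : 0 < l.length := List.length_pos_iff.2 hl
  have hex : ∃ k, 0 < k ∧ ht (l.map Prod.fst) k = 0 := ⟨l.length, hpos, w1⟩
  obtain ⟨k, ⟨hk0, hkz⟩, hkl, hmin⟩ : ∃ k, (0 < k ∧ ht (l.map Prod.fst) k = 0) ∧ k ≤ l.length ∧
      ∀ m, 0 < m → m < k → 0 < ht (l.map Prod.fst) m := by
    refine ⟨Nat.find hex, Nat.find_spec hex, Nat.find_min' hex ⟨hpos, w1⟩, fun m hm hmk => ?_⟩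
    have := Nat.find_min hex hmk
    have h2 := w2 m
    by_contra hcon
    exact this ⟨hm, by omega⟩
  obtain ⟨⟨x, c⟩, l', rfl⟩ := List.exists_cons_of_ne_nil hl
  simp only [List.map_cons, List.length_cons] at *
  have hx : x = true := by
    have := w2 (0 + 1)
    rw [ht_cons, ht_zero] at this
    cases x
    · simp at this
    · rfl
  subst hx
  have hk1 : k ≠ 1 := by
    rintro rfl
    have := ht_cons true (l'.map Prod.fst) 0
    rw [ht_zero] at this
    simp at this; omega
  obtain ⟨p, rfl⟩ : ∃ p, k = p + 2 := ⟨k - 2, by omega⟩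
  have hp : p < l'.length := by omega
  have hsplit : l' = l'.take p ++ (l'[p] :: l'.drop (p + 1)) := by
    rw [← List.drop_eq_getElem_cons hp, List.take_append_drop]
  have hal : (l'.take p).length = p := by simp; omega
  generalize l'.take p = a at *
  generalize l'.drop (p + 1) = b at *
  generalize l'[p] = y at *
  obtain ⟨y, d⟩ := y
  subst hsplit
  have hAl : (a.map Prod.fst).length = p := by simpa using hal
  simp only [List.map_append, List.map_cons] at *
  have h1 : ∀ m, m ≤ p → ht (true :: (a.map Prod.fst ++ y :: b.map Prod.fst)) (m + 1)
      = 1 + ht (a.map Prod.fst) m := by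
    intro m hm
    rw [ht_cons, ht_append_left _ _ _ (by omega)]; simp
  have h2 : ht (true :: (a.map Prod.fst ++ y :: b.map Prod.fst)) (p + 1 + 1)
      = 1 + (ht (a.map Prod.fst) p + if y then 1 else -1) := by
    conv_lhs => rw [ht_cons, ← hAl, ht_append_right, ← zero_add 1, ht_cons, ht_zero, hAl]
    simp
  have h3 := hmin (p + 1) (by omega) (by omega)
  rw [h1 p le_rfl] at h3
  have h4 : 1 + (ht (a.map Prod.fst) p + if y then 1 else -1) = 0 := by rw [← h2]; exact hkz
  have hy : y = false := by
    cases y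
    · rfl
    · simp at h4; omega
  subst hy
  have h5 : ht (a.map Prod.fst) p = 0 := by simpa using h4
  refine ⟨c, d, a, b, rfl, by rw [hal]; exact h5, fun m => ?_⟩
  rcases Nat.lt_or_ge p m with hm | hm
  · rw [ht_of_length_le _ _ (by omega), hAl, h5]
  · have := hmin (m + 1) (by omega) (by omega)
    rw [h1 m hm] at this; omega

theorem CD_exists_tree {α : Type} (n : ℕ) : ∀ l : List (Bool × α), l.length ≤ n → CD l →
    ∃ t : CTree α, t.enc = l := by
  induction n with
  | zero =>
    intro l hl _
    have : l = [] := List.length_eq_zero_iff.1 (by omega)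
    exact ⟨CTree.nil, by simp [CTree.enc, this]⟩
  | succ n ih =>
    intro l hl h
    by_cases h0 : l = []
    · exact ⟨CTree.nil, by simp [CTree.enc, h0]⟩
    · obtain ⟨c, d, a, b, rfl, h1, h2⟩ := exists_decomp l h h0
      obtain ⟨ha, hb, rfl⟩ := (CD_node c d a b).1 ⟨h, h1, h2⟩
      simp only [List.length_cons, List.length_append] at hl
      obtain ⟨t1, rfl⟩ := ih a (by omega) ha
      obtain ⟨t2, rfl⟩ := ih b (by omega) hb
      exact ⟨CTree.node c t1 t2, rfl⟩

/-! ### The statistic -/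

/-- The sum of the two statistics on a list. -/
noncomputable def SS {s : ℕ} (l : List (Bool × Fin s)) : ℕ :=
  peaksCount (l.map Prod.fst) + monoValleysCount l

/-- Contribution of two adjacent letters. -/
noncomputable def pairW {s : ℕ} (x y : Bool × Fin s) : ℕ :=
  if x.1 then (if y.1 then 0 else 1) else (if y.1 then (if x.2 = y.2 then 1 else 0) else 0)

theorem SS_cons_cons {s : ℕ} (x y : Bool × Fin s) (l : List (Bool × Fin s)) :
    SS (x :: y :: l) = pairW x y + SS (y :: l) := by
  obtain ⟨x, c⟩ := x
  obtain ⟨y, d⟩ := y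
  unfold SS peaksCount monoValleysCount pairW
  cases x <;> cases y <;> by_cases h : c = d <;>
    simp [List.count_cons, h] <;> ring

/-- Contribution of a letter followed by a tree word. -/
noncomputable def lead {s : ℕ} (x : Bool × Fin s) (t : CTree (Fin s)) : ℕ :=
  if x.1 then 0 else CTree.rho x.2 t

theorem SS_mid {s : ℕ} (t : CTree (Fin s)) : ∀ (x : Bool × Fin s) (d : Fin s) rest,
    SS (x :: (t.enc ++ (false, d) :: rest)) =
      t.st + (if x.1 then t.nu else 0) + lead x t + SS ((false, d) :: rest) := by
  induction t with
  | nil =>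
    intro x d rest
    obtain ⟨x, c⟩ := x
    simp only [CTree.enc, List.nil_append, SS_cons_cons]
    cases x <;> simp [pairW, lead, CTree.st, CTree.nu, CTree.rho]
  | node c l r ihl ihr =>
    intro x d rest
    obtain ⟨x, c'⟩ := x
    simp only [CTree.enc, List.cons_append, List.append_assoc]
    rw [SS_cons_cons, ihl, ihr]
    cases x <;> simp [pairW, lead, CTree.st, CTree.nu, CTree.rho] <;> ring

theorem SS_end {s : ℕ} (t : CTree (Fin s)) : ∀ (x : Bool × Fin s),
    SS (x :: t.enc) = t.st + lead x t := by
  induction t with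
  | nil =>
    intro x
    simp [CTree.enc, CTree.st, SS, lead, CTree.rho, peaksCount, monoValleysCount]
  | node c l r ihl ihr =>
    intro x
    obtain ⟨x, c'⟩ := x
    simp only [CTree.enc]
    rw [SS_cons_cons, SS_mid, ihr]
    cases x <;> simp [pairW, lead, CTree.st, CTree.nu, CTree.rho] <;> ring

theorem SS_enc {s : ℕ} (t : CTree (Fin s)) : SS t.enc = t.st := by
  cases t with
  | nil => simp [CTree.enc, CTree.st, SS, peaksCount, monoValleysCount]
  | node c l r =>
    simp only [CTree.enc]
    rw [SS_mid, SS_end]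
    simp [lead, CTree.st]; ring

theorem count_add_count (l : List Bool) : l.count true + l.count false = l.length := by
  induction l with
  | nil => rfl
  | cons x l ih => cases x <;> simp [List.count_cons] <;> omega

theorem isColoredDyck_iff (s n : ℕ) (w : Fin (2 * n) → Bool × Fin s) :
    IsColoredDyck s n w ↔ CD (List.ofFn w) := by
  have hmap : (List.ofFn w).map Prod.fst = List.ofFn (fun p => (w p).1) := by
    rw [List.map_ofFn]; rfl
  have hmap2 : (List.ofFn w).map Prod.snd = List.ofFn (fun p => (w p).2) := by
    rw [List.map_ofFn]; rfl
  have hlen : (List.ofFn (fun p => (w p).1)).length = 2 * n := List.length_ofFn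
  unfold IsColoredDyck IsDyckWord CD
  rw [hmap, hmap2, List.length_ofFn]
  have hc := count_add_count (List.ofFn (fun p => (w p).1))
  have h0 : ht (List.ofFn (fun p => (w p).1)) (2 * n) =
      (List.ofFn (fun p => (w p).1)).count true - (List.ofFn (fun p => (w p).1)).count false := by
    rw [ht, List.take_of_length_le (by omega)]
  constructor
  · rintro ⟨⟨h1, h2⟩, h3⟩
    have hb : ∀ m ≤ 2 * n, 0 ≤ ht (List.ofFn (fun p => (w p).1)) m := by
      intro m hm
      have := h2 m hm
      unfold ht; omega
    refine ⟨by rw [h0]; omega, fun m => ?_, fun i j hm => ?_⟩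
    · rcases Nat.lt_or_ge (2 * n) m with h | h
      · rw [ht_of_length_le _ _ (by omega), hlen]
        exact hb _ le_rfl
      · exact hb m h
    · have hj := hm.2.1
      have hi := hm.1
      have := h3 ⟨i, by omega⟩ ⟨j, by omega⟩ hm
      rw [List.getElem?_ofFn, List.getElem?_ofFn, dif_pos (by omega), dif_pos (by omega), this]
  · rintro ⟨h1, h2, h3⟩
    refine ⟨⟨by omega, fun m _ => ?_⟩, fun i j hm => ?_⟩
    · have := h2 m
      unfold ht at this; omega
    · have := h3 i j hm
      rw [List.getElem?_ofFn, List.getElem?_ofFn, dif_pos i.2, dif_pos j.2] at this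
      simpa using this

theorem total_eq (s n : ℕ) (hs : 1 ≤ s) :
    (∑ w : Fin (2 * n) → Bool × Fin s,
          (if IsColoredDyck s n w then
            peaksCount (List.ofFn (fun p => (w p).1)) + monoValleysCount (List.ofFn w)
          else 0)) = ∑ t ∈ CTree.trees (Fin s) n, t.st := by
  rw [← Finset.sum_filter]
  symm
  have key : ∀ t ∈ CTree.trees (Fin s) n, List.ofFn (fun k : Fin (2 * n) =>
      t.enc.getD k (false, (⟨0, hs⟩ : Fin s))) = t.enc := by
    intro t ht
    have hsz := (CTree.mem_trees t n).1 ht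
    have hl := CTree.length_enc t
    rw [hsz] at hl
    apply List.ext_getElem
    · simp [hl]
    · intro i h1 h2
      simp [List.getElem?_eq_getElem h2]
  refine Finset.sum_bij (fun t _ => fun k : Fin (2 * n) =>
      t.enc.getD k (false, (⟨0, hs⟩ : Fin s))) ?_ ?_ ?_ ?_
  · intro t ht
    rw [Finset.mem_filter, isColoredDyck_iff, key t ht]
    exact ⟨Finset.mem_univ _, CD_enc t⟩
  · intro t ht t' ht' h
    apply CTree.enc_inj
    rw [← key t ht, ← key t' ht']
    exact congrArg List.ofFn h
  · intro w hw
    rw [Finset.mem_filter, isColoredDyck_iff] at hw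
    obtain ⟨t, ht⟩ := CD_exists_tree _ _ le_rfl hw.2
    have hl := CTree.length_enc t
    rw [ht, List.length_ofFn] at hl
    have hmem : t ∈ CTree.trees (Fin s) n := (CTree.mem_trees t n).2 (by omega)
    refine ⟨t, hmem, ?_⟩
    apply List.ofFn_injective
    rw [key t hmem, ht]
  · intro t ht
    have h := SS_enc t
    rw [← key t ht] at h
    rw [← h, SS, List.map_ofFn]
    rfl

/-- for `s ≥ 1` and `n ≥ 1`, the total number of peaks plus monochromatic
valleys, summed over all `s`-colored Dyck words of semilength `n`, satisfies
`2s · (total) = ((s+1)n + (s−1)) · sⁿ · C_n`. -/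
theorem colored_dyck_peaks_mono_valleys (s n : ℕ) (hs : 1 ≤ s) (hn : 1 ≤ n) :
    2 * s *
        (∑ w : Fin (2 * n) → Bool × Fin s,
          (if IsColoredDyck s n w then
            peaksCount (List.ofFn (fun p => (w p).1)) + monoValleysCount (List.ofFn w)
          else 0))
      = ((s + 1) * n + (s - 1)) * s ^ n * catalan n := by
  rw [total_eq s n hs]
  have h := CTree.sum_st (α := Fin s) n
  rw [if_neg (by omega), sub_zero, Fintype.card_fin] at h
  zify [hs]
  rw [← h]
  push_cast
  ring
end

section
/- For d = 2 (alphabet {1, 2}): for all integers n, k ≥ 0 and every irreducible string x of length k over {1, 2} (i.e., a length-k word with alternating letters), the number of words of length 2n + k over {1, 2} whose irreducible string equals x is binomial(2n + k, n). In particular, the number of fully reducible words of length 2n over {1, 2} is binomial(2n, n). -/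
open scoped Classical

/-- Number of words of length `N` whose final stack is `s`. -/
noncomputable def cntStack (N : ℕ) (s : List (Fin 2)) : ℕ :=
  ∑ w : Fin N → Fin 2, if (List.ofFn w).foldl redStep [] = s then 1 else 0

lemma redStep_irr (t : List (Fin 2)) (a : Fin 2) (h : t.IsChain (· ≠ ·)) :
    (redStep t a).IsChain (· ≠ ·) := by
  cases t with
  | nil => simp [redStep]
  | cons b r =>
    unfold redStep
    by_cases hab : a = b
    · simpa [hab] using h.tail
    · simpa [hab] using h

lemma redStep_invol (t : List (Fin 2)) (a : Fin 2) (h : t.IsChain (· ≠ ·)) :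
    redStep (redStep t a) a = t := by
  cases t with
  | nil => simp [redStep]
  | cons b r =>
    by_cases hab : a = b
    · subst hab
      cases r with
      | nil => simp [redStep]
      | cons c r =>
        have : a ≠ c := by simp at h; exact h.1
        simp [redStep, this]
    · simp [redStep, hab]

lemma foldl_irr (l t : List (Fin 2)) (h : t.IsChain (· ≠ ·)) :
    (l.foldl redStep t).IsChain (· ≠ ·) := by
  induction l generalizing t with
  | nil => simpa using h
  | cons a l ih => exact ih _ (redStep_irr t a h)

lemma cntStack_succ (N : ℕ) (s : List (Fin 2)) (h : s.IsChain (· ≠ ·)) :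
    cntStack (N + 1) s = cntStack N (redStep s 0) + cntStack N (redStep s 1) := by
  have key : ∀ (a : Fin 2) (w : Fin N → Fin 2),
      ((List.ofFn (Fin.snoc w a : Fin (N + 1) → Fin 2)).foldl redStep [] = s) ↔
      ((List.ofFn w).foldl redStep [] = redStep s a) := by
    intro a w
    rw [List.ofFn_succ']
    simp only [Fin.snoc_castSucc, Fin.snoc_last, List.concat_eq_append, List.foldl_append,
      List.foldl_cons, List.foldl_nil]
    constructor
    · intro e
      rw [← e, redStep_invol _ _ (foldl_irr _ _ (by simp))]
    · intro e
      rw [e, redStep_invol _ _ h]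
  unfold cntStack
  rw [← (Fin.snocEquiv (fun _ : Fin (N + 1) => Fin 2)).sum_comp, Fintype.sum_prod_type,
    Fin.sum_univ_two]
  congr 1 <;> refine Finset.sum_congr rfl fun w _ => ?_
  · simp only [Fin.snocEquiv, Equiv.coe_fn_mk, key]
  · simp only [Fin.snocEquiv, Equiv.coe_fn_mk, key]

lemma cntStack_cons (N : ℕ) (b : Fin 2) (r : List (Fin 2)) (h : (b :: r).IsChain (· ≠ ·)) :
    ∃ t : List (Fin 2), t.length = r.length + 2 ∧ t.IsChain (· ≠ ·) ∧
      cntStack (N + 1) (b :: r) = cntStack N r + cntStack N t := by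
  have hs := cntStack_succ N _ h
  fin_cases b
  · refine ⟨1 :: 0 :: r, by simp, by simpa using h, ?_⟩
    simpa [redStep] using hs
  · refine ⟨0 :: 1 :: r, by simp, by simpa using h, ?_⟩
    rw [add_comm (cntStack N r)]
    simpa [redStep] using hs

lemma cntStack_zero_of_lt (N : ℕ) (s : List (Fin 2)) (h : s.IsChain (· ≠ ·))
    (hl : N < s.length) : cntStack N s = 0 := by
  induction N generalizing s with
  | zero =>
    cases s with
    | nil => simp at hl
    | cons b r => simp [cntStack]
  | succ N ih =>
    cases s with
    | nil => simp at hl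
    | cons b r =>
      obtain ⟨t, ht, hc, e⟩ := cntStack_cons N b r h
      simp at hl
      rw [e, ih r h.tail hl, ih t hc (by omega)]

lemma cntStack_eq (N n : ℕ) (s : List (Fin 2)) (h : s.IsChain (· ≠ ·))
    (hN : N = 2 * n + s.length) : cntStack N s = N.choose n := by
  induction N generalizing s n with
  | zero =>
    have h0 : s = [] := List.length_eq_zero_iff.mp (by omega)
    have : n = 0 := by omega
    subst h0 this
    simp [cntStack]
  | succ N ih =>
    cases s with
    | nil =>
      obtain ⟨m, rfl⟩ : ∃ m, n = m + 1 := ⟨n - 1, by simp at hN; omega⟩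
      simp at hN
      rw [cntStack_succ N _ h, ih m (redStep [] 0) (by simp [redStep]) (by simp [redStep]; omega),
        ih m (redStep [] 1) (by simp [redStep]) (by simp [redStep]; omega), Nat.choose_succ_succ]
      congr 1
      exact Nat.choose_symm_of_eq_add (by omega)
    | cons b r =>
      obtain ⟨t, ht, hc, e⟩ := cntStack_cons N b r h
      simp at hN
      rw [e, ih n r h.tail (by omega)]
      cases n with
      | zero => simp [cntStack_zero_of_lt N t hc (by omega)]
      | succ m => rw [ih m t hc (by omega), Nat.choose_succ_succ, add_comm]

/-- for `d = 2`, the number of words of length `2n + k` over `{1, 2}` whose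
irreducible string equals a given irreducible string `x` of length `k` (an alternating
word) is `binomial(2n + k, n)`; in particular (`k = 0`, `x = []`), the number of fully
reducible words of length `2n` is `binomial(2n, n)`. -/
theorem pf2_count_words (n k : ℕ) (x : List (Fin 2))
    (hlen : x.length = k) (hirr : x.Chain' (· ≠ ·)) :
    Nat.card {w : Fin (2 * n + k) → Fin 2 // irrOf w = x}
      = Nat.choose (2 * n + k) n := by
  subst hlen
  have hc : x.reverse.IsChain (· ≠ ·) := by
    rw [List.isChain_reverse]
    exact List.IsChain.imp (fun _ _ h => h.symm) hirr
  rw [← cntStack_eq (2 * n + x.length) n x.reverse hc (by simp), Nat.card_eq_fintype_card,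
    Fintype.card_subtype, Finset.card_filter]
  unfold cntStack irrOf
  refine Finset.sum_congr rfl fun w _ => ?_
  simp only [List.reverse_eq_iff]
end

section
/- For d = 2 (alphabet {1, 2}): for all integers n, k ≥ 0 with N := 2n + k ≥ 1 and every irreducible string x of length k over {1, 2} (an alternating word), N · Σ_w #{i ∈ {1,…,N−1} : w_i = w_{i+1}} = 2n(n+k) · binomial(N, n), where the sum ranges over all words w of length N whose irreducible string equals x; equivalently, the average number of adjacent equal-letter pairs in such words equals N/2 − k²/(2N). -/
open scoped Classical

/-- The number of indices `i` with `w_i = w_{i+1}` (adjacent equal-letter pairs). -/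
def pairsCount {d : ℕ} (l : List (Fin d)) : ℕ :=
  (List.zipWith (fun a b => decide (a = b)) l l.tail).count true

namespace PF2

/-- Sum of `f` over all words of length `N`. -/
noncomputable def F (N : ℕ) (f : List (Fin 2) → ℕ) : ℕ :=
  ∑ w : Fin N → Fin 2, f (List.ofFn w)

lemma F_zero (f : List (Fin 2) → ℕ) : F 0 f = f [] := by
  simp [F]

lemma F_succ (N : ℕ) (f : List (Fin 2) → ℕ) :
    F (N + 1) f = F N (fun l => f (0 :: l)) + F N (fun l => f (1 :: l)) := by
  unfold F
  rw [← (Fin.consEquiv (fun _ : Fin (N + 1) => Fin 2)).sum_comp, Fintype.sum_prod_type]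
  simp [Fin.sum_univ_two, Fin.consEquiv, List.ofFn_succ]

/-- Direction of a letter. -/
def sg (a : Fin 2) : ℤ := if a = 0 then 1 else -1

/-- Position of a stack on the line. -/
def pos : List (Fin 2) → ℤ
  | [] => 0
  | a :: s => pos s + sg a * (-1) ^ s.length

lemma pos_step (s : List (Fin 2)) (a : Fin 2) :
    pos (redStep s a) = pos s + sg a * (-1) ^ s.length := by
  cases s with
  | nil => simp [redStep, pos]
  | cons b r =>
    unfold redStep
    by_cases h : a = b
    · subst h
      simp [pos, pow_succ]
    · simp [h, pos]

/-- Irreducible stacks. -/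
abbrev Irr (s : List (Fin 2)) : Prop := s.IsChain (· ≠ ·)

lemma irr_step (s : List (Fin 2)) (a : Fin 2) (hs : Irr s) : Irr (redStep s a) := by
  cases s with
  | nil => simp [redStep, Irr]
  | cons b r =>
    by_cases h : a = b
    · simp only [redStep, h, if_true]
      exact hs.tail
    · simp only [redStep, h, if_false]
      exact List.isChain_cons_cons.2 ⟨h, hs⟩

lemma step_step (s : List (Fin 2)) (a : Fin 2) (hs : Irr s) :
    redStep (redStep s a) a = s := by
  rcases s with _ | ⟨b, _ | ⟨c, r⟩⟩
  · simp [redStep]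
  · by_cases h : a = b <;> simp [redStep, h]
  · have hbc := (List.isChain_cons_cons.1 hs).1
    by_cases h : a = b <;> simp [redStep, h, hbc]

lemma pos_irr (s : List (Fin 2)) (a : Fin 2) (hs : Irr (a :: s)) :
    pos (a :: s) = (s.length + 1) * (sg a * (-1) ^ s.length) := by
  induction s generalizing a with
  | nil => simp [pos]
  | cons b r ih =>
    have h := List.isChain_cons_cons.1 hs
    have hab : sg b = - sg a := by
      have := h.1
      fin_cases a <;> fin_cases b <;> simp_all [sg]
    rw [pos, ih b h.2, hab]
    simp only [List.length_cons]
    push_cast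
    ring

lemma sg_pow (a : Fin 2) (n : ℕ) : sg a * (-1) ^ n = 1 ∨ sg a * (-1) ^ n = -1 := by
  rcases neg_one_pow_eq_or ℤ n with h | h <;> fin_cases a <;> simp [sg, h]

lemma pos_or (s : List (Fin 2)) (hs : Irr s) : pos s = s.length ∨ pos s = - s.length := by
  cases s with
  | nil => simp [pos]
  | cons a r =>
    rw [pos_irr r a hs]
    rcases sg_pow a r.length with h | h <;> rw [h] <;> simp

lemma pos_inj (s t : List (Fin 2)) (hs : Irr s) (ht : Irr t) (h : pos s = pos t) : s = t := by
  have hl : s.length = t.length := by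
    rcases pos_or s hs with h1 | h1 <;> rcases pos_or t ht with h2 | h2 <;> omega
  induction s generalizing t with
  | nil => symm; simpa using hl.symm
  | cons a r ih =>
    cases t with
    | nil => simp at hl
    | cons b q =>
      have hl' : r.length = q.length := by simpa using hl
      have hab : a = b := by
        rw [pos_irr r a hs, pos_irr q b ht, hl'] at h
        have h0 : ((q.length : ℤ) + 1) ≠ 0 := by positivity
        have h1 := mul_left_cancel₀ h0 h
        have h2 := mul_right_cancel₀ (pow_ne_zero _ (by norm_num)) h1
        fin_cases a <;> fin_cases b <;> simp_all [sg]
      subst hab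
      rw [ih q hs.tail ht.tail _ hl']
      simpa [pos, hl'] using h

/-- Number of words of length `N` leading from stack `s` to stack `T`. -/
noncomputable def G (N : ℕ) (s T : List (Fin 2)) : ℕ :=
  F N (fun l => if l.foldl redStep s = T then 1 else 0)

/-- Total number of adjacent pairs in such words. -/
noncomputable def P (N : ℕ) (s T : List (Fin 2)) : ℕ :=
  F N (fun l => if l.foldl redStep s = T then pairsCount l else 0)

lemma G_succ (N : ℕ) (s T : List (Fin 2)) :
    G (N + 1) s T = G N (redStep s 0) T + G N (redStep s 1) T := by
  unfold G
  rw [F_succ]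
  rfl

lemma G_zero (s T : List (Fin 2)) : G 0 s T = if s = T then 1 else 0 := by
  rw [G, F_zero]
  rfl

lemma step_cases (s : List (Fin 2)) :
    (pos (redStep s 0) = pos s + 1 ∧ pos (redStep s 1) = pos s - 1) ∨
    (pos (redStep s 0) = pos s - 1 ∧ pos (redStep s 1) = pos s + 1) := by
  rw [pos_step, pos_step]
  rcases neg_one_pow_eq_or ℤ s.length with h | h <;> rw [h] <;> simp [sg] <;> omega

lemma G_low (N : ℕ) (s T : List (Fin 2)) (h : pos T < pos s - N) : G N s T = 0 := by
  induction N generalizing s with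
  | zero =>
    rw [G_zero, if_neg]
    rintro rfl
    simp at h
  | succ N ih =>
    rw [G_succ]
    push_cast at h
    rcases step_cases s with ⟨h1, h2⟩ | ⟨h1, h2⟩ <;>
      rw [ih _ (by omega), ih _ (by omega)]

lemma G_eq (N m : ℕ) (s T : List (Fin 2)) (hs : Irr s) (hT : Irr T)
    (h : pos T = pos s + 2 * m - N) : G N s T = N.choose m := by
  induction N generalizing s m with
  | zero =>
    rw [G_zero]
    cases m with
    | zero =>
      rw [if_pos (pos_inj s T hs hT (by simpa using h.symm))]
      simp
    | succ m =>
      rw [if_neg]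
      · simp
      · rintro rfl
        push_cast at h
        omega
  | succ N ih =>
    rw [G_succ]
    push_cast at h
    cases m with
    | zero =>
      rcases step_cases s with ⟨h1, h2⟩ | ⟨h1, h2⟩
      · rw [G_low N _ T (by push_cast at h; omega),
          ih 0 _ (irr_step _ _ hs) (by push_cast at *; omega)]
        simp
      · rw [G_low N (redStep s 1) T (by push_cast at h; omega),
          ih 0 _ (irr_step _ _ hs) (by push_cast at *; omega)]
        simp
    | succ m =>
      push_cast at h
      rw [Nat.choose_succ_succ]
      rcases step_cases s with ⟨h1, h2⟩ | ⟨h1, h2⟩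
      · rw [ih m _ (irr_step s 0 hs) (by omega),
          ih (m + 1) _ (irr_step s 1 hs) (by push_cast; omega)]
      · rw [ih m _ (irr_step s 1 hs) (by omega),
          ih (m + 1) _ (irr_step s 0 hs) (by push_cast; omega), add_comm]

lemma pc_cons (a b : Fin 2) (l : List (Fin 2)) :
    pairsCount (a :: b :: l) = (if a = b then 1 else 0) + pairsCount (b :: l) := by
  unfold pairsCount
  by_cases h : a = b <;> simp [h, add_comm]

lemma F_add (N : ℕ) (f g : List (Fin 2) → ℕ) : F N (fun l => f l + g l) = F N f + F N g := by
  simp [F, Finset.sum_add_distrib]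

lemma P_one (s T : List (Fin 2)) : P 1 s T = 0 := by
  simp [P, F_succ, F_zero, pairsCount]

/-- Words starting with letter `a`. -/
lemma P_rec (N : ℕ) (s T : List (Fin 2)) (hs : Irr s) :
    P (N + 2) s T = 2 * G N s T + (P (N + 1) (redStep s 0) T + P (N + 1) (redStep s 1) T) := by
  have key : ∀ a b : Fin 2, F N (fun l => if (a :: b :: l).foldl redStep s = T
      then pairsCount (a :: b :: l) else 0) =
      (if a = b then G N s T else 0) +
      F N (fun l => if (b :: l).foldl redStep (redStep s a) = T
        then pairsCount (b :: l) else 0) := by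
    intro a b
    by_cases h : a = b
    · subst h
      rw [if_pos rfl, G, ← F_add]
      congr 1
      funext l
      simp only [List.foldl_cons, step_step s a hs, pc_cons]
      split_ifs <;> simp
    · rw [if_neg h, Nat.zero_add]
      congr 1
      funext l
      rw [pc_cons, if_neg h, Nat.zero_add]
      rfl
  unfold P
  rw [F_succ (N + 1), F_succ N, F_succ N, F_succ N, F_succ N, key, key, key, key,
    if_pos rfl, if_pos rfl, if_neg (by decide), if_neg (by decide)]
  ring

lemma P_eq (N : ℕ) (s T : List (Fin 2)) (hs : Irr s) :
    P (N + 2) s T = 2 * (N + 1) * G N s T := by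
  induction N generalizing s with
  | zero => rw [P_rec 0 s T hs, P_one, P_one]; ring
  | succ N ih =>
    rw [P_rec _ s T hs, ih _ (irr_step _ _ hs), ih _ (irr_step _ _ hs), G_succ]
    ring

end PF2

/-- for `d = 2` and `N = 2n + k ≥ 1`, for every irreducible string `x` of
length `k` over `{1, 2}`, we have
`N · Σ_w #{i : w_i = w_{i+1}} = 2n(n+k) · binomial(N, n)`, the sum ranging over words
`w` of length `N` whose irreducible string equals `x`; equivalently, the average number
of adjacent equal-letter pairs equals `N/2 − k²/(2N)`. -/
theorem pf2_total_pairs_irreducible (n k : ℕ) (hN : 1 ≤ 2 * n + k) (x : List (Fin 2))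
    (hlen : x.length = k) (hirr : x.Chain' (· ≠ ·)) :
    (2 * n + k) *
        (∑ w : Fin (2 * n + k) → Fin 2,
          (if irrOf w = x then pairsCount (List.ofFn w) else 0))
      = 2 * n * (n + k) * Nat.choose (2 * n + k) n := by
  have hT : PF2.Irr x.reverse := by
    have h1 : x.IsChain (· ≠ ·) := hirr
    refine List.isChain_reverse.2 ?_
    exact h1.imp (fun a b h => h.symm)
  have hsum : (∑ w : Fin (2 * n + k) → Fin 2,
      (if irrOf w = x then pairsCount (List.ofFn w) else 0)) = PF2.P (2 * n + k) [] x.reverse := by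
    unfold PF2.P PF2.F
    refine Finset.sum_congr rfl fun w _ => ?_
    have : irrOf w = x ↔ (List.ofFn w).foldl redStep [] = x.reverse := by
      unfold irrOf
      exact List.reverse_eq_iff
    simp only [this]
  rw [hsum]
  have hnil : PF2.Irr [] := List.isChain_nil
  have hpos := PF2.pos_or _ hT
  rw [List.length_reverse, hlen] at hpos
  have h0 : PF2.pos [] = 0 := rfl
  cases n with
  | zero =>
    simp only [Nat.mul_zero, Nat.zero_add, Nat.zero_mul, Nat.mul_eq_zero]
    right
    rcases k with _ | _ | k
    · simp at hN
    · exact PF2.P_one _ _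
    · rw [PF2.P_eq k _ _ hnil]
      rcases hpos with h | h
      · rw [PF2.G_eq k (k + 1) _ _ hnil hT (by rw [h, h0]; push_cast; ring)]
        simp
      · rw [PF2.G_low k _ _ (by rw [h, h0]; push_cast; omega)]
        simp
  | succ n =>
    have hG : PF2.G (2 * n + k) [] x.reverse = (2 * n + k).choose n := by
      rcases hpos with h | h
      · rw [PF2.G_eq _ (n + k) _ _ hnil hT (by rw [h, h0]; push_cast; ring)]
        exact Nat.choose_symm_of_eq_add (by ring)
      · exact PF2.G_eq _ n _ _ hnil hT (by rw [h, h0]; push_cast; ring)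
    have e : 2 * (n + 1) + k = 2 * n + k + 2 := by ring
    rw [e, PF2.P_eq _ _ _ hnil, hG]
    have c1 := Nat.add_one_mul_choose_eq (2 * n + k + 1) n
    have c3 := Nat.choose_mul_succ_eq (2 * n + k) n
    have e3 : 2 * n + k + 1 - n = n + 1 + k := by omega
    rw [e3] at c3
    calc (2 * n + k + 2) * (2 * (2 * n + k + 1) * (2 * n + k).choose n)
        = 2 * (2 * n + k + 2) * ((2 * n + k).choose n * (2 * n + k + 1)) := by ring
      _ = 2 * (n + 1 + k) * ((2 * n + k + 1 + 1) * (2 * n + k + 1).choose n) := by rw [c3]; ring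
      _ = _ := by rw [c1]; ring
end

section
/- For every integer d ≥ 2 and every n ≥ 1, the number W_n^{(d)} of fully reducible words of length 2n over {1,…,d} satisfies the recursion W_n^{(d)} = Σ_{i=0}^{n−1} d · (d−1)^{n−1−i} · C_{n−1−i} · W_i^{(d)}, where C_m = (1/(m+1))·binomial(2m, m) is the m-th Catalan number and W_0^{(d)} = 1. -/
open scoped Classical

/-- `W d m` is the number of fully reducible words of length `2m` over `{1,…,d}`. -/
noncomputable def W (d m : ℕ) : ℕ :=
  Nat.card {w : Fin (2 * m) → Fin d // FullyReducible w}

/-- Number of letter sequences of length `m` that empty a stack of height `h`. -/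
def cntH (d : ℕ) : ℕ → ℕ → ℕ
  | 0, 0 => 1
  | 0, _ + 1 => 0
  | m + 1, 0 => d * cntH d m 1
  | m + 1, h + 1 => cntH d m h + (d - 1) * cntH d m (h + 2)

theorem sum_words_eq (d m : ℕ) : ∀ s : List (Fin d),
    (∑ w : Fin m → Fin d, if (List.ofFn w).foldl redStep s = [] then 1 else 0)
      = cntH d m s.length := by
  induction m with
  | zero =>
    intro s
    cases s <;> simp [cntH]
  | succ m ih =>
    intro s
    rw [← (Fin.consEquiv (fun _ : Fin (m + 1) => Fin d)).sum_comp, Fintype.sum_prod_type]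
    have h1 : ∀ a : Fin d, (∑ w : Fin m → Fin d,
        if (List.ofFn ((Fin.consEquiv (fun _ : Fin (m + 1) => Fin d)) (a, w))).foldl redStep s = []
          then 1 else 0) = cntH d m (redStep s a).length := by
      intro a
      rw [← ih]
      apply Finset.sum_congr rfl
      intro w _
      simp [Fin.consEquiv, List.ofFn_succ]
    rw [Finset.sum_congr rfl (fun a _ => h1 a)]
    cases s with
    | nil => simp [redStep, cntH]
    | cons b r =>
      rw [← Finset.add_sum_erase _ _ (Finset.mem_univ b)]
      have h2 : ∀ a ∈ Finset.univ.erase b, cntH d m (redStep (b :: r) a).length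
          = cntH d m (r.length + 2) := by
        intro a ha
        simp [redStep, Finset.ne_of_mem_erase ha]
      rw [Finset.sum_congr rfl h2]
      simp [redStep, cntH, Finset.card_erase_of_mem]

theorem W_eq_cntH (d n : ℕ) : W d n = cntH d (2 * n) 0 := by
  have := sum_words_eq d (2 * n) []
  rw [List.length_nil] at this
  rw [← this, W, Nat.card_eq_fintype_card, Fintype.card_subtype, Finset.card_filter]
  apply Finset.sum_congr rfl
  intro w _
  simp [FullyReducible, irrOf]

open PowerSeries in
theorem scaledCatalan_eq (q : ℕ) :
    (PowerSeries.mk (fun k => q ^ k * catalan k) : PowerSeries ℕ)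
      = 1 + PowerSeries.X * (PowerSeries.C q *
        ((PowerSeries.mk (fun k => q ^ k * catalan k)) ^ 2)) := by
  ext n
  cases n with
  | zero => simp
  | succ n =>
    rw [map_add, PowerSeries.coeff_succ_X_mul, PowerSeries.coeff_C_mul, sq,
      PowerSeries.coeff_mul, PowerSeries.coeff_mk, catalan_succ', Finset.mul_sum,
      Finset.mul_sum]
    simp only [PowerSeries.coeff_one, Nat.succ_ne_zero, if_false, zero_add]
    apply Finset.sum_congr rfl
    rintro ⟨i, j⟩ hij
    replace hij : i + j = n := Finset.HasAntidiagonal.mem_antidiagonal.mp hij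
    simp only [PowerSeries.coeff_mk]
    subst hij
    ring

theorem coeff_pow_mul (d : ℕ) : ∀ N n h : ℕ, 2 * n + h = N →
    PowerSeries.coeff n ((PowerSeries.mk (fun k => (d - 1) ^ k * catalan k)) ^ h
      * PowerSeries.mk (fun k => cntH d (2 * k) 0)) = cntH d (2 * n + h) h := by
  intro N
  induction N with
  | zero =>
    intro n h hN
    obtain rfl : h = 0 := by omega
    simp
  | succ N ih =>
    intro n h hN
    cases h with
    | zero => simp
    | succ h =>
      have key : ∀ A G : PowerSeries ℕ, A = 1 + PowerSeries.X * (PowerSeries.C (d - 1) * A ^ 2) →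
          A ^ (h + 1) * G = A ^ h * G +
            PowerSeries.X * (PowerSeries.C (d - 1) * (A ^ (h + 2) * G)) := by
        intro A G hA
        calc A ^ (h + 1) * G = A ^ h * A * G := by ring
          _ = A ^ h * (1 + PowerSeries.X * (PowerSeries.C (d - 1) * A ^ 2)) * G := by rw [← hA]
          _ = _ := by ring
      rw [key _ _ (scaledCatalan_eq (d - 1)), map_add, ih n h (by omega)]
      cases n with
      | zero =>
        have hz : ∀ k m : ℕ, m < k → cntH d m k = 0 := by
          intro k m
          induction m generalizing k with
          | zero => intro hk; cases k with
            | zero => omega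
            | succ k => rfl
          | succ m ihm => intro hk; cases k with
            | zero => omega
            | succ k => simp [cntH, ihm k (by omega), ihm (k + 2) (by omega)]
        rw [show 2 * 0 + (h + 1) = (2 * 0 + h) + 1 by ring]
        simp [cntH, hz (h + 2) h (by omega)]
      | succ n =>
        rw [PowerSeries.coeff_succ_X_mul, PowerSeries.coeff_C_mul, ih n (h + 2) (by omega),
          show 2 * (n + 1) + (h + 1) = (2 * (n + 1) + h) + 1 by ring,
          show 2 * n + (h + 2) = 2 * (n + 1) + h by ring]
        simp [cntH]

/-- `W_0^{(d)} = 1` and for every `n ≥ 1`,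
`W_n^{(d)} = Σ_{i=0}^{n−1} d · (d−1)^{n−1−i} · C_{n−1−i} · W_i^{(d)}`,
where `C_m` is the `m`-th Catalan number. -/
theorem pf_W_recursion (d : ℕ) (hd : 2 ≤ d) :
    W d 0 = 1 ∧
    ∀ n : ℕ, 1 ≤ n →
      W d n = ∑ i ∈ Finset.range n,
        d * (d - 1) ^ (n - 1 - i) * catalan (n - 1 - i) * W d i := by
  refine ⟨by simp [W_eq_cntH, cntH], ?_⟩
  intro n hn
  obtain ⟨n, rfl⟩ : ∃ m, n = m + 1 := ⟨n - 1, by omega⟩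
  simp only [W_eq_cntH, Nat.add_sub_cancel]
  have h := coeff_pow_mul d _ n 1 rfl
  rw [pow_one, mul_comm, PowerSeries.coeff_mul,
    Finset.Nat.sum_antidiagonal_eq_sum_range_succ_mk] at h
  rw [show 2 * (n + 1) = (2 * n + 1) + 1 by ring, cntH, ← h, Finset.mul_sum]
  apply Finset.sum_congr rfl
  intro i _
  simp only [PowerSeries.coeff_mk]
  ring
end

section
/- For every integer d ≥ 2 and every n ≥ 0, the series Σ_{j=0}^∞ ((d−1)/d²)^j · C_{n+j} converges, and the number of fully reducible words of length 2n over {1,…,d} equals W_n^{(d)} = ((d−1)^{n+1}/d) · Σ_{j=0}^∞ ((d−1)/d²)^j · C_{n+j}, where C_m = (1/(m+1))·binomial(2m, m) is the m-th Catalan number. -/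
open scoped Classical

/-- Real-valued count of the words of length `N` that empty the stack `s`. -/
noncomputable def cntR (d N : ℕ) (s : List (Fin d)) : ℝ :=
  ∑ w : Fin N → Fin d, if (List.ofFn w).foldl redStep s = [] then (1 : ℝ) else 0

lemma cntR_zero (d : ℕ) (s : List (Fin d)) : cntR d 0 s = if s = [] then 1 else 0 := by
  simp [cntR]

lemma cntR_succ (d N : ℕ) (s : List (Fin d)) :
    cntR d (N + 1) s = ∑ a : Fin d, cntR d N (redStep s a) := by
  unfold cntR
  rw [← (Fin.consEquiv (fun _ : Fin (N + 1) => Fin d)).sum_comp, Fintype.sum_prod_type]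
  refine Finset.sum_congr rfl fun a _ => Finset.sum_congr rfl fun w _ => ?_
  simp [Fin.consEquiv, List.ofFn_succ]

lemma W_eq_cntR (d n : ℕ) : (W d n : ℝ) = cntR d (2 * n) [] := by
  unfold W cntR FullyReducible irrOf
  rw [Nat.card_eq_fintype_card, Fintype.card_subtype]
  simp

open PowerSeries in
/-- The rescaled Catalan generating function. -/
noncomputable def serK (q : ℝ) : PowerSeries ℝ := PowerSeries.mk fun n => q ^ n * (catalan n : ℝ)

open PowerSeries in
lemma serK_eq (q : ℝ) : serK q = 1 + C q * (X * serK q ^ 2) := by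
  ext n
  cases n with
  | zero => simp [serK]
  | succ n =>
    rw [map_add, coeff_C_mul, coeff_succ_X_mul, sq, coeff_mul, coeff_one, if_neg n.succ_ne_zero]
    simp only [serK, coeff_mk, catalan_succ', zero_add]
    push_cast
    rw [Finset.mul_sum, Finset.mul_sum]
    refine Finset.sum_congr rfl fun ij hij => ?_
    rw [← Finset.HasAntidiagonal.mem_antidiagonal.1 hij]
    ring

open PowerSeries in
/-- First-passage series. -/
noncomputable def serU (q : ℝ) : PowerSeries ℝ := X * expand 2 two_ne_zero (serK q)

open PowerSeries in
lemma serU_eq (q : ℝ) : serU q = X + C q * (X * serU q ^ 2) := by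
  have h := congrArg (expand 2 two_ne_zero) (serK_eq q)
  simp only [map_add, map_mul, map_pow, map_one, expand_C, expand_X] at h
  unfold serU
  linear_combination X * h

open PowerSeries in
lemma coeff_serU (q : ℝ) (n : ℕ) : coeff (2 * n + 1) (serU q) = q ^ n * catalan n := by
  unfold serU
  rw [coeff_succ_X_mul, coeff_expand_mul]
  simp [serK]

open PowerSeries in
/-- Return series. -/
noncomputable def serW (d : ℕ) : PowerSeries ℝ := (1 - C (d : ℝ) * (X * serU ((d : ℝ) - 1)))⁻¹

open PowerSeries in
lemma serW_mul (d : ℕ) : (1 - C (d : ℝ) * (X * serU ((d : ℝ) - 1))) * serW d = 1 := by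
  unfold serW
  exact PowerSeries.mul_inv_cancel _ (by simp)

open PowerSeries in
lemma serW_eq (d : ℕ) : serW d * (1 - C (d : ℝ) ^ 2 * X ^ 2) =
    1 - C (d : ℝ) * (C ((d : ℝ) - 1) * (X * serU ((d : ℝ) - 1))) := by
  have h1 := serW_mul d
  have h2 := serU_eq ((d : ℝ) - 1)
  have h3 : (C ((d : ℝ) - 1) : PowerSeries ℝ) = C (d : ℝ) - 1 := by simp
  generalize serU ((d : ℝ) - 1) = u at *
  generalize serW d = w at *
  rw [h3] at *
  generalize (C (d : ℝ) : PowerSeries ℝ) = D at *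
  linear_combination (1 - D * ((D - 1) * (X * u))) * h1 + D ^ 2 * X * w * h2

open PowerSeries in
lemma cntR_eq (d N : ℕ) : ∀ s : List (Fin d),
    cntR d N s = coeff N (serU ((d : ℝ) - 1) ^ s.length * serW d) := by
  induction N with
  | zero =>
    intro s
    rw [cntR_zero]
    cases s with
    | nil => simp [serW]
    | cons b r => simp [serU]
  | succ N ih =>
    intro s
    rw [cntR_succ]
    cases s with
    | nil =>
      have h : serW d = 1 + C (d : ℝ) * (X * (serU ((d : ℝ) - 1) * serW d)) := by
        linear_combination serW_mul d
      simp only [redStep, ih, List.length_nil, pow_zero, one_mul, List.length_singleton, pow_one]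
      conv_rhs => rw [h]
      rw [map_add, coeff_C_mul, coeff_succ_X_mul, coeff_one, if_neg N.succ_ne_zero]
      simp
    | cons b r =>
      have h : serU ((d : ℝ) - 1) ^ (r.length + 1) * serW d =
          X * (serU ((d : ℝ) - 1) ^ r.length * serW d) +
          C ((d : ℝ) - 1) * (X * (serU ((d : ℝ) - 1) ^ (r.length + 2) * serW d)) := by
        linear_combination (serU ((d : ℝ) - 1) ^ r.length * serW d) * serU_eq ((d : ℝ) - 1)
      rw [List.length_cons, h, map_add, coeff_C_mul, coeff_succ_X_mul, coeff_succ_X_mul,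
        ← Finset.add_sum_erase _ _ (Finset.mem_univ b)]
      congr 1
      · simp [redStep, ih]
      · rw [Finset.sum_congr rfl (g := fun _ =>
          coeff N (serU ((d : ℝ) - 1) ^ (r.length + 2) * serW d))]
        · have : 1 ≤ d := b.pos
          simp [Finset.card_erase_of_mem, Nat.cast_sub this]
        · intro a ha
          simp [redStep, Finset.ne_of_mem_erase ha, ih]

open PowerSeries in
lemma W_rec (d n : ℕ) : (W d (n + 1) : ℝ) =
    (d : ℝ) ^ 2 * W d n - d * ((d : ℝ) - 1) ^ (n + 1) * catalan n := by
  have h := congrArg (coeff (2 * n + 1 + 1)) (serW_eq d)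
  have e : serW d * (1 - C (d : ℝ) ^ 2 * X ^ 2) =
      serW d - C ((d : ℝ) ^ 2) * (X * (X * serW d)) := by
    rw [map_pow]; ring
  rw [e, map_sub, map_sub, coeff_C_mul, coeff_C_mul, coeff_C_mul, coeff_succ_X_mul,
    coeff_succ_X_mul, coeff_succ_X_mul, coeff_serU, coeff_one, if_neg (Nat.succ_ne_zero _)] at h
  rw [W_eq_cntR, W_eq_cntR, cntR_eq, cntR_eq]
  simp only [List.length_nil, pow_zero, one_mul]
  rw [show 2 * (n + 1) = 2 * n + 1 + 1 by ring]
  linear_combination h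

lemma W_zero (d : ℕ) : (W d 0 : ℝ) = 1 := by
  rw [W_eq_cntR]; simp [cntR_zero]

lemma partial_sum (d : ℕ) (hd : 2 ≤ d) (J : ℕ) :
    ∑ j ∈ Finset.range J, (((d : ℝ) - 1) / (d : ℝ) ^ 2) ^ j * (catalan j : ℝ) =
      d / ((d : ℝ) - 1) -
      (((d : ℝ) - 1) / (d : ℝ) ^ 2) ^ J * (W d J * d / ((d : ℝ) - 1) ^ (J + 1)) := by
  have h2 : (2 : ℝ) ≤ d := by exact_mod_cast hd
  have hq : (d : ℝ) - 1 ≠ 0 := by linarith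
  have hd0 : (d : ℝ) ≠ 0 := by linarith
  induction J with
  | zero => simp [W_zero]
  | succ J ih =>
    rw [Finset.sum_range_succ, ih, W_rec]
    simp only [div_pow]
    field_simp
    ring

lemma base_sum (d : ℕ) (hd : 2 ≤ d) :
    HasSum (fun j : ℕ => (((d : ℝ) - 1) / (d : ℝ) ^ 2) ^ j * (catalan j : ℝ))
      (d / ((d : ℝ) - 1)) := by
  have h2 : (2 : ℝ) ≤ d := by exact_mod_cast hd
  have hq : 0 < (d : ℝ) - 1 := by linarith
  have hd0 : 0 < (d : ℝ) := by linarith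
  set x : ℝ := ((d : ℝ) - 1) / (d : ℝ) ^ 2 with hx
  have hx0 : 0 ≤ x := by positivity
  have hnn : ∀ j : ℕ, 0 ≤ x ^ j * (catalan j : ℝ) := fun j => by positivity
  have hb : ∀ J, ∑ j ∈ Finset.range J, x ^ j * (catalan j : ℝ) ≤ d / ((d : ℝ) - 1) := by
    intro J
    rw [partial_sum d hd J]
    have : 0 ≤ x ^ J * (W d J * d / ((d : ℝ) - 1) ^ (J + 1)) := by positivity
    linarith
  have hs : Summable (fun j : ℕ => x ^ j * (catalan j : ℝ)) :=
    summable_of_sum_range_le hnn hb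
  have hle := hs.tsum_le_of_sum_range_le hb
  have hquad : ∑' j : ℕ, x ^ j * (catalan j : ℝ) =
      1 + x * ((∑' j : ℕ, x ^ j * (catalan j : ℝ)) * ∑' j : ℕ, x ^ j * (catalan j : ℝ)) := by
    rw [tsum_mul_tsum_eq_tsum_sum_antidiagonal_of_summable_norm hs.norm hs.norm, ← tsum_mul_left,
      hs.tsum_eq_zero_add]
    simp only [pow_zero, catalan_zero, Nat.cast_one, mul_one]
    congr 1
    refine tsum_congr fun n => ?_
    rw [catalan_succ']
    push_cast
    rw [Finset.mul_sum, Finset.mul_sum]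
    refine Finset.sum_congr rfl fun ij hij => ?_
    rw [← Finset.HasAntidiagonal.mem_antidiagonal.1 hij]
    ring
  have hS : ∑' j : ℕ, x ^ j * (catalan j : ℝ) = d / ((d : ℝ) - 1) := by
    generalize ∑' j : ℕ, x ^ j * (catalan j : ℝ) = S at *
    have hf : (S - d) * (((d : ℝ) - 1) * S - d) = 0 := by
      rw [hx] at hquad
      field_simp at hquad
      linear_combination -hquad
    rcases mul_eq_zero.1 hf with h | h
    · have hSd : S = d := by linarith
      rw [le_div_iff₀ hq] at hle
      rw [eq_div_iff hq.ne']
      nlinarith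
    · rw [eq_div_iff hq.ne']
      linarith
  rw [← hS]
  exact hs.hasSum

lemma full_sum (d : ℕ) (hd : 2 ≤ d) (n : ℕ) :
    HasSum (fun j : ℕ => (((d : ℝ) - 1) / (d : ℝ) ^ 2) ^ j * (catalan (n + j) : ℝ))
      (W d n * d / ((d : ℝ) - 1) ^ (n + 1)) := by
  have h2 : (2 : ℝ) ≤ d := by exact_mod_cast hd
  have hq : (d : ℝ) - 1 ≠ 0 := by linarith
  have hd0 : (d : ℝ) ≠ 0 := by linarith
  induction n with
  | zero => simpa [W_zero] using base_sum d hd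
  | succ n ih =>
    have h := (hasSum_nat_add_iff' 1).2 ih
    have h' := h.mul_left ((((d : ℝ) - 1) / (d : ℝ) ^ 2)⁻¹)
    have e1 : (fun j : ℕ => (((d : ℝ) - 1) / (d : ℝ) ^ 2) ^ j * (catalan (n + 1 + j) : ℝ)) =
        fun j : ℕ => (((d : ℝ) - 1) / (d : ℝ) ^ 2)⁻¹ *
          ((((d : ℝ) - 1) / (d : ℝ) ^ 2) ^ (j + 1) * (catalan (n + (j + 1)) : ℝ)) := by
      funext j
      rw [show n + 1 + j = n + (j + 1) by ring]
      simp only [div_pow]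
      field_simp
      ring
    have e2 : W d (n + 1) * d / ((d : ℝ) - 1) ^ (n + 1 + 1) = (((d : ℝ) - 1) / (d : ℝ) ^ 2)⁻¹ *
        (W d n * d / ((d : ℝ) - 1) ^ (n + 1) - ∑ i ∈ Finset.range 1,
          (((d : ℝ) - 1) / (d : ℝ) ^ 2) ^ i * (catalan (n + i) : ℝ)) := by
      rw [W_rec]
      simp only [Finset.sum_range_one, pow_zero, add_zero]
      field_simp
      ring
    rw [e1, e2]
    exact h'

/-- the series `Σ_j ((d−1)/d²)^j · C_{n+j}` converges and
`W_n^{(d)} = ((d−1)^{n+1}/d) · Σ_{j=0}^∞ ((d−1)/d²)^j · C_{n+j}`,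
where `C_m` is the `m`-th Catalan number. -/
theorem pf_W_series (d : ℕ) (hd : 2 ≤ d) (n : ℕ) :
    Summable (fun j : ℕ =>
      (((d : ℝ) - 1) / (d : ℝ) ^ 2) ^ j * (catalan (n + j) : ℝ)) ∧
    (W d n : ℝ) = (((d : ℝ) - 1) ^ (n + 1) / (d : ℝ)) *
      ∑' j : ℕ, (((d : ℝ) - 1) / (d : ℝ) ^ 2) ^ j * (catalan (n + j) : ℝ) := by
  have h2 : (2 : ℝ) ≤ d := by exact_mod_cast hd
  have hq : (d : ℝ) - 1 ≠ 0 := by linarith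
  have hd0 : (d : ℝ) ≠ 0 := by linarith
  have h := full_sum d hd n
  refine ⟨h.summable, ?_⟩
  rw [h.tsum_eq]
  field_simp
end

section
/- For every integer d ≥ 3, all integers n, k ≥ 0, and every irreducible string x of length k over {1,…,d}, the number W_{n,k}^{(d)}(x) of words of length 2n + k whose irreducible string equals x satisfies (d−1)^n · C_{n,k} ≤ W_{n,k}^{(d)}(x) ≤ (d(d−1)/(d−2)²) · (d−1)^n · C_{n,k}, where C_{n,k} = ((k+1)/(n+k+1))·binomial(2n+k, n) and C_{n,0} = C_n is the n-th Catalan number. -/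
open scoped Classical

/-- `Wx d N x` is the number of words of length `N` over `{1,…,d}` whose irreducible
string equals `x`. -/
noncomputable def Wx (d N : ℕ) (x : List (Fin d)) : ℕ :=
  Nat.card {w : Fin N → Fin d // irrOf w = x}

/-- `Cnk m j = ((j+1)/(m+j+1)) · binomial(2m+j, m)`, as a real number;
`Cnk m 0 = C_m` is the `m`-th Catalan number. -/
noncomputable def Cnk (m j : ℕ) : ℝ :=
  ((j + 1) * Nat.choose (2 * m + j) m : ℝ) / ((m + j + 1 : ℕ) : ℝ)

/-! Auxiliary lemmas -/

lemma pf_Cnk_zero (k : ℕ) : Cnk 0 k = 1 := by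
  unfold Cnk
  have : ((k : ℝ) + 1) ≠ 0 := by positivity
  simp [this]

lemma pf_Cnk_pos (n k : ℕ) : 0 < Cnk n k := by
  unfold Cnk
  have : 0 < Nat.choose (2 * n + k) n := Nat.choose_pos (by omega)
  positivity

lemma pf_Cnk_rec (n k : ℕ) : Cnk (n+1) (k+1) = Cnk (n+1) k + Cnk n (k+2) := by
  unfold Cnk
  have e1 : 2 * (n+1) + (k+1) = (2*n+k+2) + 1 := by ring
  have e2 : 2 * (n+1) + k = 2*n+k+2 := by ring
  have e3 : 2 * n + (k+2) = 2*n+k+2 := by ring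
  rw [e1, e2, e3, Nat.choose_succ_succ]
  have h := Nat.choose_succ_right_eq (2*n+k+2) n
  have e4 : 2*n+k+2 - n = n+k+2 := by omega
  rw [e4] at h
  have h' : ((Nat.choose (2*n+k+2) (n+1) : ℕ) : ℝ) * (n+1) = (Nat.choose (2*n+k+2) n : ℕ) * (n+k+2) := by
    exact_mod_cast h
  have hb : ((Nat.choose (2*n+k+2) (n+1) : ℕ) : ℝ) = (Nat.choose (2*n+k+2) n : ℕ) * (n+k+2) / (n+1) := by
    rw [eq_div_iff (by positivity)]; exact h'
  push_cast
  rw [hb]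
  have p1 : (n:ℝ)+1 ≠ 0 := by positivity
  have p2 : (n:ℝ)+k+2 ≠ 0 := by positivity
  have p3 : (n:ℝ)+k+3 ≠ 0 := by positivity
  have q1 : (n:ℝ)+1+(k+1)+1 = n+k+3 := by ring
  have q2 : (n:ℝ)+1+k+1 = n+k+2 := by ring
  have q3 : (n:ℝ)+(k+2)+1 = n+k+3 := by ring
  rw [q1, q2, q3]
  field_simp
  ring

lemma pf_Cnk_bdry (n : ℕ) : Cnk (n+1) 0 = Cnk n 1 := by
  unfold Cnk
  have e1 : 2 * (n+1) + 0 = (2*n+1) + 1 := by ring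
  rw [e1, Nat.choose_succ_succ]
  have h : Nat.choose (2*n+1) (n+1) = Nat.choose (2*n+1) n := by
    apply Nat.choose_symm_of_eq_add; ring
  rw [h]
  push_cast
  have p3 : (n:ℝ)+2 ≠ 0 := by positivity
  have q1 : (n:ℝ)+1+0+1 = n+2 := by ring
  have q2 : (n:ℝ)+1+1 = n+2 := by ring
  rw [q1, q2]
  field_simp
  ring

lemma pf_Cnk_mono (n k : ℕ) : Cnk n k ≤ Cnk n (k+1) := by
  cases n with
  | zero => simp [pf_Cnk_zero]
  | succ n => rw [pf_Cnk_rec]; linarith [pf_Cnk_pos n (k+2)]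

lemma pf_Cnk_mono' (n k j : ℕ) : Cnk n k ≤ Cnk n (k+j) := by
  induction j with
  | zero => simp
  | succ j ih => exact ih.trans (pf_Cnk_mono n (k+j))

lemma pf_Cnk_ratio (n k : ℕ) : Cnk n (k+1) * (k+1) ≤ 2 * (k+2) * Cnk n k := by
  unfold Cnk
  have h := Nat.choose_mul_succ_eq (2*n+k) n
  have e4 : 2*n+k+1 - n = n+k+1 := by omega
  rw [e4] at h
  have h' : ((Nat.choose (2*n+k) n : ℕ) : ℝ) * (2*n+k+1) = (Nat.choose (2*n+k+1) n : ℕ) * (n+k+1) := by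
    exact_mod_cast h
  have hb : ((Nat.choose (2*n+k+1) n : ℕ) : ℝ) = (Nat.choose (2*n+k) n : ℕ) * (2*n+k+1) / (n+k+1) := by
    rw [eq_div_iff (by positivity)]; exact h'.symm
  have e1 : 2 * n + (k+1) = 2*n+k+1 := by ring
  rw [e1, hb]
  push_cast
  rw [← sub_nonneg]
  have : 2 * ((k:ℝ) + 2) * ((k + 1) * ((Nat.choose (2*n+k) n : ℕ) : ℝ) / (n + k + 1)) -
    (k + 1 + 1) * (((Nat.choose (2*n+k) n : ℕ) : ℝ) * (2 * n + k + 1) / (n + k + 1)) / (n + (k + 1) + 1) * (k + 1)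
    = (k+2)*(k+1)*((Nat.choose (2*n+k) n : ℕ) : ℝ) * (k+3) / ((n+k+1)*(n+(k+1)+1)) := by
    field_simp
    ring
  rw [this]
  positivity

lemma pf_Cnk_ratio' (n k j : ℕ) : Cnk n (k+j) * (k+1) ≤ 2^j * (k+j+1) * Cnk n k := by
  induction j with
  | zero => simp; linarith
  | succ j ih =>
    have h := pf_Cnk_ratio n (k+j)
    push_cast at h ⊢
    have p : (0:ℝ) < k+j+1 := by positivity
    have e : k + (j+1) = k+j+1 := by ring
    rw [e]
    refine le_of_mul_le_mul_right ?_ p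
    calc Cnk n (k+j+1) * (k+1) * (k+j+1) = (Cnk n (k+j+1) * (k+j+1)) * (k+1) := by ring
      _ ≤ (2 * (k+j+2) * Cnk n (k+j)) * (k+1) := by gcongr
      _ = 2 * (k+j+2) * (Cnk n (k+j) * (k+1)) := by ring
      _ ≤ 2 * (k+j+2) * (2^j * (k+j+1) * Cnk n k) := by gcongr
      _ = _ := by ring

lemma pf_Cnk_bound (n k j : ℕ) : Cnk n (k+j) ≤ (j+1) * 2^j * Cnk n k := by
  have h := pf_Cnk_ratio' n k j
  have p : (0:ℝ) < k+1 := by positivity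
  refine le_of_mul_le_mul_right (h.trans ?_) p
  have := pf_Cnk_pos n k
  have h2 : (k:ℝ)+j+1 ≤ (j+1)*(k+1) := by nlinarith [mul_nonneg (Nat.cast_nonneg (α := ℝ) k) (Nat.cast_nonneg (α := ℝ) j)]
  calc (2:ℝ)^j * (k+j+1) * Cnk n k ≤ 2^j * ((j+1)*(k+1)) * Cnk n k := by gcongr
    _ = _ := by ring

lemma pf_geom (d : ℕ) (hd : 3 ≤ d) :
    HasSum (fun j : ℕ => ((j:ℝ)+1) * (2/(d:ℝ))^j) (1/(1-2/(d:ℝ))^2) := by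
  have hd' : (3:ℝ) ≤ d := by exact_mod_cast hd
  have h0 : (0:ℝ) ≤ 2/d := by positivity
  have h1 : (2:ℝ)/d < 1 := by rw [div_lt_one (by linarith)]; linarith
  have hs := (hasSum_coe_mul_geometric_of_norm_lt_one (𝕜 := ℝ) (r := 2/d)
    (by rw [Real.norm_of_nonneg h0]; exact h1)).add (hasSum_geometric_of_lt_one h0 h1)
  have e1 : (fun j : ℕ => ((j:ℝ)+1) * (2/(d:ℝ))^j)
      = fun j : ℕ => (j:ℝ) * (2/(d:ℝ))^j + (2/(d:ℝ))^j := by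
    funext j; ring
  have e2 : (1:ℝ)/(1-2/(d:ℝ))^2 = 2/(d:ℝ)/(1-2/(d:ℝ))^2 + (1-2/(d:ℝ))⁻¹ := by
    have : (1:ℝ) - 2/d ≠ 0 := by linarith
    generalize (2:ℝ)/d = r at *
    field_simp
    ring
  rw [e1, e2]
  exact hs

/-- the summand -/
noncomputable def pfT (d n k j : ℕ) : ℝ := (1/(d:ℝ))^j * Cnk n (k+j)

lemma pfT_nonneg (d n k j : ℕ) : 0 ≤ pfT d n k j := by
  unfold pfT; have := pf_Cnk_pos n (k+j); positivity

lemma pfT_le (d n k j : ℕ) : pfT d n k j ≤ (((j:ℝ)+1) * (2/(d:ℝ))^j) * Cnk n k := by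
  unfold pfT
  calc (1/(d:ℝ))^j * Cnk n (k+j) ≤ (1/(d:ℝ))^j * ((j+1) * 2^j * Cnk n k) := by
        gcongr; exact pf_Cnk_bound n k j
    _ = _ := by rw [div_pow, div_pow]; ring

lemma pfT_summable (d n k : ℕ) (hd : 3 ≤ d) : Summable (pfT d n k) :=
  Summable.of_nonneg_of_le (pfT_nonneg d n k) (pfT_le d n k) ((pf_geom d hd).summable.mul_right _)

/-- the sum -/
noncomputable def pfS (d n k : ℕ) : ℝ := ∑' j, pfT d n k j

lemma pfS_le (d n k : ℕ) (hd : 3 ≤ d) : pfS d n k ≤ 1/(1-2/(d:ℝ))^2 * Cnk n k :=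
  hasSum_le (pfT_le d n k) (pfT_summable d n k hd).hasSum ((pf_geom d hd).mul_right (Cnk n k))

lemma pf_geom1 (d : ℕ) (hd : 3 ≤ d) :
    HasSum (fun j : ℕ => (1/(d:ℝ))^j) ((d:ℝ)/(d-1)) := by
  have hd' : (3:ℝ) ≤ d := by exact_mod_cast hd
  have h1 : (1:ℝ)/d < 1 := by rw [div_lt_one (by linarith)]; linarith
  have hs := hasSum_geometric_of_lt_one (r := 1/(d:ℝ)) (by positivity) h1
  convert hs using 1
  have : (d:ℝ) - 1 ≠ 0 := by linarith
  have : (d:ℝ) ≠ 0 := by linarith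
  field_simp

lemma pfS_ge (d n k : ℕ) (hd : 3 ≤ d) : (d:ℝ)/(d-1) * Cnk n k ≤ pfS d n k := by
  refine hasSum_le ?_ ((pf_geom1 d hd).mul_right (Cnk n k)) (pfT_summable d n k hd).hasSum
  intro j
  unfold pfT
  gcongr
  exact pf_Cnk_mono' n k j

lemma pfS_zero (d k : ℕ) (hd : 3 ≤ d) : pfS d 0 k = (d:ℝ)/(d-1) := by
  have h : pfT d 0 k = fun j : ℕ => (1/(d:ℝ))^j := by
    ext j; simp [pfT, pf_Cnk_zero]
  rw [pfS, h, (pf_geom1 d hd).tsum_eq]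

lemma pfS_rec (d n k : ℕ) (hd : 3 ≤ d) : pfS d (n+1) (k+1) = pfS d (n+1) k + pfS d n (k+2) := by
  unfold pfS
  rw [← (pfT_summable d (n+1) k hd).tsum_add (pfT_summable d n (k+2) hd)]
  congr 1
  ext j
  unfold pfT
  have e1 : k + 1 + j = (k+j)+1 := by ring
  have e2 : k + 2 + j = (k+j)+2 := by ring
  rw [e1, e2, pf_Cnk_rec]
  ring

lemma pfS_bdry (d n : ℕ) (hd : 3 ≤ d) : ((d:ℝ)-1) * pfS d (n+1) 0 = d * pfS d n 1 := by
  have hd' : (3:ℝ) ≤ d := by exact_mod_cast hd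
  have h1 : pfS d (n+1) 0 = Cnk n 1 + 1/(d:ℝ) * pfS d (n+1) 1 := by
    unfold pfS
    rw [(pfT_summable d (n+1) 0 hd).tsum_eq_zero_add, ← tsum_mul_left]
    congr 1
    · simp [pfT, pf_Cnk_bdry]
    · congr 1; ext j; unfold pfT
      rw [show 0 + (j+1) = 1 + j by ring]; ring
  have h2 : pfS d n 1 = Cnk n 1 + 1/(d:ℝ) * pfS d n 2 := by
    unfold pfS
    rw [(pfT_summable d n 1 hd).tsum_eq_zero_add, ← tsum_mul_left]
    congr 1
    · simp [pfT]
    · congr 1; ext j; unfold pfT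
      rw [show 1 + (j+1) = 2 + j by ring]; ring
  have h3 := pfS_rec d n 0 hd
  simp only [zero_add] at h3
  have hne : (d:ℝ) ≠ 0 := by linarith
  field_simp at h1 h2
  rw [h3] at h1
  linarith

/-- closed form of the counts -/
noncomputable def pfF (d n k : ℕ) : ℝ := ((d:ℝ)-1)^n * (((d:ℝ)-1)/d * pfS d n k)

lemma pfF_zero (d k : ℕ) (hd : 3 ≤ d) : pfF d 0 k = 1 := by
  have hd' : (3:ℝ) ≤ d := by exact_mod_cast hd
  have : (d:ℝ) - 1 ≠ 0 := by linarith
  have : (d:ℝ) ≠ 0 := by linarith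
  rw [pfF, pfS_zero d k hd]; field_simp

lemma pfF_rec (d n k : ℕ) (hd : 3 ≤ d) :
    pfF d (n+1) (k+1) = pfF d (n+1) k + ((d:ℝ)-1) * pfF d n (k+2) := by
  simp only [pfF, pfS_rec d n k hd]; ring

lemma pfF_bdry (d n : ℕ) (hd : 3 ≤ d) : pfF d (n+1) 0 = d * pfF d n 1 := by
  have hd' : (3:ℝ) ≤ d := by exact_mod_cast hd
  have : (d:ℝ) ≠ 0 := by linarith
  have h := pfS_bdry d n hd
  unfold pfF
  calc _ = ((d:ℝ)-1)^n * (((d:ℝ)-1)/d * (((d:ℝ)-1) * pfS d (n+1) 0)) := by ring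
    _ = _ := by rw [h]; ring

/-- counts by final stack -/
noncomputable def pfCnt (d N : ℕ) (t : List (Fin d)) : ℕ :=
  Fintype.card {w : Fin N → Fin d // (List.ofFn w).foldl redStep [] = t}

lemma pf_redStep_chain {d : ℕ} (s : List (Fin d)) (a : Fin d) (h : s.IsChain (· ≠ ·)) :
    (redStep s a).IsChain (· ≠ ·) := by
  cases s with
  | nil => simp [redStep]
  | cons b r =>
    unfold redStep
    by_cases hab : a = b
    · simp only [hab, if_true]; exact h.tail
    · simp only [hab, if_false]; exact List.isChain_cons_cons.2 ⟨hab, h⟩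

lemma pf_redStep_invol {d : ℕ} (s : List (Fin d)) (a : Fin d) (h : s.IsChain (· ≠ ·)) :
    redStep (redStep s a) a = s := by
  cases s with
  | nil => simp [redStep]
  | cons b r =>
    by_cases hab : a = b
    · subst hab
      cases r with
      | nil => simp [redStep]
      | cons c r =>
        have := (List.isChain_cons_cons.1 h).1
        simp [redStep, this]
    · simp [redStep, hab]

lemma pf_foldl_chain {d : ℕ} (l s : List (Fin d)) (h : s.IsChain (· ≠ ·)) :
    (l.foldl redStep s).IsChain (· ≠ ·) := by
  induction l generalizing s with
  | nil => exact h
  | cons a l ih => exact ih _ (pf_redStep_chain s a h)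

lemma pfCnt_succ (d N : ℕ) (t : List (Fin d)) (ht : t.IsChain (· ≠ ·)) :
    pfCnt d (N+1) t = ∑ a : Fin d, pfCnt d N (redStep t a) := by
  unfold pfCnt
  rw [← Fintype.card_sigma]
  refine Fintype.card_congr ?_
  have key : ∀ (w : Fin N → Fin d) (a : Fin d),
      (List.ofFn (Fin.snoc w a : Fin (N+1) → Fin d)).foldl redStep [] = t ↔
      (List.ofFn w).foldl redStep [] = redStep t a := by
    intro w a
    rw [List.ofFn_succ']
    simp only [Fin.snoc_castSucc, Fin.snoc_last, List.concat_eq_append, List.foldl_append,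
      List.foldl_cons, List.foldl_nil]
    constructor
    · intro h
      rw [← h, pf_redStep_invol _ _ (pf_foldl_chain _ _ List.isChain_nil)]
    · intro h
      rw [h, pf_redStep_invol _ _ ht]
  exact
    { toFun := fun w => ⟨w.1 (Fin.last N), fun i => w.1 i.castSucc, by
        rw [← key]
        have := w.2
        rwa [← Fin.snoc_init_self w.1] at this⟩
      invFun := fun p => ⟨Fin.snoc p.2.1 p.1, (key _ _).2 p.2.2⟩
      left_inv := fun w => Subtype.ext (Fin.snoc_init_self w.1)
      right_inv := by
        rintro ⟨a, w, hw⟩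
        apply Sigma.subtype_ext
        · simp
        · funext i; simp }

lemma pf_redStep_length {d : ℕ} (s : List (Fin d)) (a : Fin d) :
    (redStep s a).length ≤ s.length + 1 := by
  cases s with
  | nil => simp [redStep]
  | cons b r => unfold redStep; by_cases hab : a = b <;> simp [hab]; omega

lemma pf_foldl_length {d : ℕ} (l s : List (Fin d)) :
    (l.foldl redStep s).length ≤ s.length + l.length := by
  induction l generalizing s with
  | nil => simp
  | cons a l ih =>
    have := ih (redStep s a)
    have := pf_redStep_length s a
    simp only [List.foldl_cons, List.length_cons]; omega

lemma pfCnt_big (d N : ℕ) (t : List (Fin d)) (h : N < t.length) : pfCnt d N t = 0 := by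
  unfold pfCnt
  rw [Fintype.card_eq_zero_iff]
  constructor
  rintro ⟨w, hw⟩
  have := pf_foldl_length (List.ofFn w) []
  rw [hw] at this
  simp at this
  omega

lemma pfCnt_cons (d N : ℕ) (b : Fin d) (r : List (Fin d)) (ht : (b :: r).IsChain (· ≠ ·)) :
    pfCnt d (N+1) (b :: r) = pfCnt d N r + ∑ a ∈ Finset.univ.erase b, pfCnt d N (a :: b :: r) := by
  rw [pfCnt_succ d N _ ht, ← Finset.add_sum_erase _ _ (Finset.mem_univ b)]
  congr 1
  · simp [redStep]
  · refine Finset.sum_congr rfl fun a ha => ?_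
    simp [redStep, Finset.ne_of_mem_erase ha]

lemma pfCnt_eq (d : ℕ) (hd : 3 ≤ d) (N : ℕ) : ∀ (n : ℕ) (t : List (Fin d)),
    t.IsChain (· ≠ ·) → N = 2 * n + t.length → (pfCnt d N t : ℝ) = pfF d n t.length := by
  induction N with
  | zero =>
    intro n t ht hN
    have hn : n = 0 := by omega
    have h0 : t = [] := List.length_eq_zero_iff.1 (by omega)
    subst hn h0
    rw [pfF_zero d _ hd]
    simp [pfCnt]
  | succ N ih =>
    intro n t ht hN
    cases t with
    | nil =>
      obtain ⟨m, rfl⟩ : ∃ m, n = m + 1 := ⟨n - 1, by simp at hN; omega⟩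
      rw [pfCnt_succ d N _ ht, List.length_nil, pfF_bdry d m hd]
      push_cast
      have : ∀ a ∈ (Finset.univ : Finset (Fin d)), (pfCnt d N (redStep [] a) : ℝ) = pfF d m 1 := by
        intro a _
        exact ih m [a] (List.isChain_singleton a) (by simp at hN ⊢; omega)
      rw [Finset.sum_congr rfl this]
      simp
    | cons b r =>
      rw [pfCnt_cons d N b r ht]
      simp only [List.length_cons] at hN ⊢
      push_cast
      rw [ih n r ht.tail (by omega)]
      cases n with
      | zero =>
        rw [pfF_zero d _ hd, pfF_zero d _ hd, Finset.sum_eq_zero]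
        · simp
        · intro a _
          rw [pfCnt_big _ _ _ (by simp; omega)]; simp
      | succ m =>
        rw [pfF_rec d m _ hd]
        have : ∀ a ∈ (Finset.univ : Finset (Fin d)).erase b,
            (pfCnt d N (a :: b :: r) : ℝ) = pfF d m (r.length + 2) := by
          intro a ha
          exact ih m (a :: b :: r) (List.isChain_cons_cons.2 ⟨Finset.ne_of_mem_erase ha, ht⟩)
            (by simp; omega)
        rw [Finset.sum_congr rfl this, Finset.sum_const, Finset.card_erase_of_mem (Finset.mem_univ b)]
        have h1 : ((d - 1 : ℕ) : ℝ) = (d:ℝ) - 1 := by rw [Nat.cast_sub (by omega)]; simp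
        simp [h1]

lemma pf_Wx_eq (d N : ℕ) (x : List (Fin d)) : Wx d N x = pfCnt d N x.reverse := by
  unfold Wx pfCnt irrOf
  rw [Nat.card_eq_fintype_card]
  refine Fintype.card_congr (Equiv.subtypeEquivRight fun w => ?_)
  exact List.reverse_eq_iff

/-- for `d ≥ 3` and any irreducible string `x` of length `k`,
`(d−1)^n · C_{n,k} ≤ W_{n,k}^{(d)}(x) ≤ (d(d−1)/(d−2)²) · (d−1)^n · C_{n,k}`. -/
theorem pf_Wnk_bounds (d : ℕ) (hd : 3 ≤ d) (n k : ℕ) (x : List (Fin d))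
    (hlen : x.length = k) (hirr : x.Chain' (· ≠ ·)) :
    ((d : ℝ) - 1) ^ n * Cnk n k ≤ (Wx d (2 * n + k) x : ℝ) ∧
    (Wx d (2 * n + k) x : ℝ) ≤
      ((d : ℝ) * ((d : ℝ) - 1) / ((d : ℝ) - 2) ^ 2) * (((d : ℝ) - 1) ^ n * Cnk n k) := by
  have hd' : (3:ℝ) ≤ d := by exact_mod_cast hd
  have hx : x.reverse.IsChain (· ≠ ·) := by
    rw [List.isChain_reverse]
    exact hirr.imp fun a b h => h.symm
  have hW : (Wx d (2 * n + k) x : ℝ) = pfF d n k := by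
    rw [pf_Wx_eq, pfCnt_eq d hd _ n x.reverse hx (by simp [hlen])]
    simp [hlen]
  have p1 : (0:ℝ) < (d:ℝ) - 1 := by linarith
  have p2 : (0:ℝ) < (d:ℝ) - 2 := by linarith
  have p0 : (0:ℝ) < (d:ℝ) := by linarith
  rw [hW, pfF]
  constructor
  · gcongr
    calc Cnk n k = ((d:ℝ)-1)/d * ((d:ℝ)/(d-1) * Cnk n k) := by field_simp
      _ ≤ _ := by gcongr; exact pfS_ge d n k hd
  · calc ((d:ℝ)-1)^n * (((d:ℝ)-1)/d * pfS d n k)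
        ≤ ((d:ℝ)-1)^n * (((d:ℝ)-1)/d * (1/(1-2/(d:ℝ))^2 * Cnk n k)) := by
          gcongr; exact pfS_le d n k hd
      _ = _ := by
          have e : (1:ℝ) - 2/d = (d-2)/d := by field_simp
          rw [e]
          field_simp
end

section
/- For every integer n ≥ 1, (4n − 1) · Σ_{j=0}^{2n} (j − n)² · binomial(2n, j)² = n² · binomial(4n, 2n). -/
theorem aux_shift (K : ℕ) :
    ∑ i ∈ Finset.range (K + 1), Nat.choose (K + 1) i * Nat.choose (K + 1) (i + 1)
      = Nat.choose (2 * (K + 1)) K := by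
  rw [two_mul, Nat.add_choose_eq, Finset.Nat.sum_antidiagonal_eq_sum_range_succ_mk]
  refine Finset.sum_congr rfl fun i hi => ?_
  have hi' : i ≤ K := by simpa [Nat.lt_succ_iff] using hi
  congr 1
  rw [← Nat.choose_symm (by omega : i + 1 ≤ K + 1)]
  congr 1
  omega

theorem aux_sum (K : ℕ) :
    ∑ j ∈ Finset.range (K + 3), (j : ℤ) * ((K : ℤ) + 2 - j) * (Nat.choose (K + 2) j : ℤ) ^ 2
      = ((K : ℤ) + 2) ^ 2 * (Nat.choose (2 * (K + 1)) K : ℤ) := by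
  rw [Finset.sum_range_succ, Finset.sum_range_succ', ← aux_shift]
  push_cast
  rw [Finset.mul_sum]
  have : ∀ i ∈ Finset.range (K + 1),
      ((i : ℤ) + 1) * ((K : ℤ) + 2 - (i + 1)) * (Nat.choose (K + 2) (i + 1) : ℤ) ^ 2
      = ((K : ℤ) + 2) ^ 2 * ((Nat.choose (K + 1) i : ℤ) * (Nat.choose (K + 1) (i + 1) : ℤ)) := by
    intro i hi
    have hi' : i ≤ K := by simpa [Nat.lt_succ_iff] using hi
    have h1 : ((K : ℤ) + 2) * (Nat.choose (K + 1) i : ℤ)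
        = (Nat.choose (K + 2) (i + 1) : ℤ) * (i + 1) := by
      have := Nat.add_one_mul_choose_eq (K + 1) i
      zify at this
      linarith
    have h2 : (Nat.choose (K + 1) (i + 1) : ℤ) * ((K : ℤ) + 2)
        = (Nat.choose (K + 2) (i + 1) : ℤ) * ((K : ℤ) + 2 - (i + 1)) := by
      have := Nat.choose_mul_succ_eq (K + 1) (i + 1)
      zify [(by omega : i + 1 ≤ K + 1 + 1)] at this
      linarith
    linear_combination (-(Nat.choose (K + 1) (i + 1) : ℤ) * ((K : ℤ) + 2)) * h1
      - ((Nat.choose (K + 2) (i + 1) : ℤ) * (i + 1)) * h2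
  rw [Finset.sum_congr rfl this]
  ring

/-- for every `n ≥ 1`,
`(4n − 1) · Σ_{j=0}^{2n} (j − n)² · binomial(2n, j)² = n² · binomial(4n, 2n)`. -/
theorem schmidt_variance_identity (n : ℕ) (hn : 1 ≤ n) :
    (4 * (n : ℤ) - 1) *
        (∑ j ∈ Finset.range (2 * n + 1),
          ((j : ℤ) - (n : ℤ)) ^ 2 * (Nat.choose (2 * n) j : ℤ) ^ 2)
      = (n : ℤ) ^ 2 * (Nat.choose (4 * n) (2 * n) : ℤ) := by
  obtain ⟨K, hK⟩ : ∃ K, 2 * n = K + 2 := ⟨2 * n - 2, by omega⟩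
  have hKz : 2 * (n : ℤ) = K + 2 := by exact_mod_cast hK
  have h4 : 4 * n = 2 * (K + 2) := by omega
  rw [h4, hK]
  have e : ∀ j ∈ Finset.range (K + 2 + 1),
      ((j : ℤ) - (n : ℤ)) ^ 2 * (Nat.choose (K + 2) j : ℤ) ^ 2
      = (n : ℤ) ^ 2 * (Nat.choose (K + 2) j : ℤ) ^ 2
        - (j : ℤ) * ((K : ℤ) + 2 - j) * (Nat.choose (K + 2) j : ℤ) ^ 2 := by
    intro j _
    rw [← hKz]
    ring
  have hsq : ∑ j ∈ Finset.range (K + 2 + 1), (Nat.choose (K + 2) j : ℤ) ^ 2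
      = (Nat.choose (2 * (K + 2)) (K + 2) : ℤ) := by
    exact_mod_cast Nat.sum_range_choose_sq (K + 2)
  rw [Finset.sum_congr rfl e, Finset.sum_sub_distrib, ← Finset.mul_sum, hsq, aux_sum]
  have c1 := Nat.succ_mul_centralBinom_succ (K + 1)
  have c2 := Nat.choose_succ_right_eq (2 * (K + 1)) K
  rw [Nat.centralBinom, Nat.centralBinom] at c1
  rw [show 2 * (K + 1) - K = K + 2 by omega] at c2
  zify at c1 c2
  rw [show K + 1 + 1 = K + 2 by rfl] at c1
  generalize (Nat.choose (2 * (K + 2)) (K + 2) : ℤ) = A at *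
  generalize (Nat.choose (2 * (K + 1)) (K + 1) : ℤ) = B at *
  generalize (Nat.choose (2 * (K + 1)) K : ℤ) = C at *
  have hKe : (K : ℤ) = 2 * n - 2 := by linarith
  have hn0 : (n : ℤ) ≠ 0 := by positivity
  rw [hKe] at c1 c2 ⊢
  apply mul_left_cancel₀ hn0
  linear_combination ((n : ℤ) ^ 2 * (2 * n - 1)) * c1 + (2 * (n : ℤ) ^ 2 * (4 * n - 1)) * c2
end
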